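/- arXiv:2309.10462 — 2 statements merged into one kernel-verified Lean document; each statement's English description precedes it below -/
import Mathlib

section
/- The number of codewords of the Reed–Muller code R(4,9) of Hamming weight exactly 56 is 271767121346560, and the number of codewords of Hamming weight exactly 60 is 860689275027456. -/
open Finset Polynomial

/-- A Boolean function in `m` variables. -/
abbrev BF (m : ℕ) := (Fin m → ZMod 2) → ZMod 2

/-- The coefficient of the monomial `∏_{i ∈ S} x i` in the algebraic normal form of `f`:
by Möbius inversion over `𝔽₂`, it equals the sum of `f x` over all inputs `x`
whose support is contained in `S`. -/
def anf {m : ℕ} (f : BF m) (S : Finset (Fin m)) : ZMod 2 :=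
  ∑ x ∈ Finset.univ.filter (fun x : Fin m → ZMod 2 => ∀ i, x i = 1 → i ∈ S), f x

/-- The Reed–Muller code `R(r,m)`: Boolean functions in `m` variables of
algebraic degree at most `r`. -/
def RM (r m : ℕ) : Finset (BF m) :=
  Finset.univ.filter (fun f => ∀ S : Finset (Fin m), r < S.card → anf f S = 0)

/-- `H^{(r)}(m)`: Boolean functions in `m` variables whose algebraic normal form is
homogeneous of degree `r`, together with the zero function. -/
def Hom (r m : ℕ) : Finset (BF m) :=
  Finset.univ.filter (fun f => ∀ S : Finset (Fin m), anf f S ≠ 0 → S.card = r)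

/-- The Hamming weight of a Boolean function. -/
def wt {m : ℕ} (f : BF m) : ℕ := (Finset.univ.filter (fun x => f x = 1)).card

/-- The coset `p + C`. -/
def coset {m : ℕ} (p : BF m) (C : Finset (BF m)) : Finset (BF m) :=
  C.image (fun g => p + g)

/-- The weight enumerator `W[z; C] = ∑_{f ∈ C} z^{wt f}` of a finite set `C` of
Boolean functions. -/
noncomputable def WE {m : ℕ} (C : Finset (BF m)) : Polynomial ℕ :=
  ∑ f ∈ C, X ^ wt f

set_option linter.unusedSectionVars false

namespace BoolFun

section Degree

variable {V : Type*} [AddCommGroup V] [Module (ZMod 2) V]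

/-- The derivative of a Boolean function in direction `a`. -/
def diff (a : V) (f : V → ZMod 2) : V → ZMod 2 := fun x => f (x + a) + f x

/-- `DegLT k f` says that `f` has algebraic degree less than `k`: all its `k`-fold derivatives
vanish. -/
def DegLT : ℕ → (V → ZMod 2) → Prop
  | 0, f => ∀ x, f x = 0
  | k + 1, f => ∀ a, DegLT k (diff a f)

theorem degLT_zero (k : ℕ) : DegLT k (0 : V → ZMod 2) := by
  induction k with
  | zero => intro x; rfl
  | succ k ih =>
    intro a
    convert ih using 1
    funext x
    simp [diff]

theorem DegLT.add {k : ℕ} {f g : V → ZMod 2} (hf : DegLT k f) (hg : DegLT k g) :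
    DegLT k (f + g) := by
  induction k generalizing f g with
  | zero => intro x; simp [hf x, hg x]
  | succ k ih =>
    intro a
    convert ih (hf a) (hg a) using 1
    funext x
    simp only [diff, Pi.add_apply]
    ring

theorem DegLT.succ {k : ℕ} {f : V → ZMod 2} (hf : DegLT k f) : DegLT (k + 1) f := by
  induction k generalizing f with
  | zero => intro a x; simp [diff, hf (x + a), hf x]
  | succ k ih => intro a; exact ih (hf a)

theorem DegLT.mono {k l : ℕ} {f : V → ZMod 2} (hf : DegLT k f) (h : k ≤ l) : DegLT l f := by
  induction h with
  | refl => exact hf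
  | step _ ih => exact ih.succ

theorem DegLT.comp {U : Type*} [AddCommGroup U] [Module (ZMod 2) U] {k : ℕ} {f : V → ZMod 2}
    (hf : DegLT k f) (L : U →ₗ[ZMod 2] V) (c : V) : DegLT k (fun y => f (L y + c)) := by
  induction k generalizing f with
  | zero => intro y; exact hf _
  | succ k ih =>
    intro a
    convert ih (hf (L a)) using 1
    funext y
    simp only [diff, map_add]
    congr 2
    abel

theorem degLT_const (c : ZMod 2) : DegLT 1 (fun _ : V => c) := by
  intro a x
  exact CharTwo.add_self_eq_zero c

theorem degLT_linear (φ : V →ₗ[ZMod 2] ZMod 2) (c : ZMod 2) : DegLT 2 (fun x => φ x + c) := by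
  intro a
  convert degLT_const (V := V) (φ a) using 1
  funext x
  simp only [diff, map_add]
  linear_combination (CharTwo.add_self_eq_zero (φ x)) + (CharTwo.add_self_eq_zero c)

theorem DegLT.mul {j k : ℕ} {f g : V → ZMod 2} (hf : DegLT j f) (hg : DegLT k g) :
    DegLT (j + k - 1) (f * g) := by
  obtain ⟨n, hn⟩ : ∃ n, n = j + k := ⟨_, rfl⟩
  induction n using Nat.strong_induction_on generalizing j k f g with
  | _ n ih =>
    subst hn
    cases j with
    | zero =>
      have : f = 0 := funext hf
      rw [this, zero_mul]
      exact degLT_zero _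
    | succ j =>
      cases k with
      | zero =>
        have : g = 0 := funext hg
        rw [this, mul_zero]
        exact degLT_zero _
      | succ k =>
        have e : j + 1 + (k + 1) - 1 = (j + k) + 1 := by omega
        rw [e]
        intro a
        have h1 := ih (j + (k + 1)) (by omega) (hf a) hg rfl
        have h2 := ih ((j + 1) + k) (by omega) hf (hg a) rfl
        have h3 := ih (j + k) (by omega) (hf a) (hg a) rfl
        have h := ((h1.mono (show _ ≤ j + k by omega)).add
          (h2.mono (show _ ≤ j + k by omega))).add (h3.mono (show _ ≤ j + k by omega))
        convert h using 1
        funext x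
        simp only [diff, Pi.add_apply, Pi.mul_apply]
        linear_combination (-1 : ZMod 2) * (CharTwo.add_self_eq_zero (f x * g x)) -
          (CharTwo.add_self_eq_zero (f x * g (x + a))) -
          (CharTwo.add_self_eq_zero (f (x + a) * g x))

theorem DegLT.eq_const {f : V → ZMod 2} (hf : DegLT 1 f) (x y : V) : f x = f y := by
  have h := hf (y - x) x
  simp only [diff, add_sub_cancel] at h
  exact (CharTwo.add_eq_zero.mp h).symm

end Degree

theorem zmod_two_cases (c : ZMod 2) : c = 0 ∨ c = 1 := by
  revert c; decide

section Support

variable {V : Type*} [Fintype V]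

/-- The support of a Boolean function. -/
def supp (f : V → ZMod 2) : Finset V := univ.filter (fun x => f x = 1)

@[simp] theorem mem_supp {f : V → ZMod 2} {x : V} : x ∈ supp f ↔ f x = 1 := by simp [supp]

theorem notMem_supp {f : V → ZMod 2} {x : V} : x ∉ supp f ↔ f x = 0 := by
  rw [mem_supp]
  rcases zmod_two_cases (f x) with h | h <;> simp [h]

theorem supp_injective : Function.Injective (supp : (V → ZMod 2) → Finset V) := by
  intro f g h
  funext x
  have := congrArg (x ∈ ·) h
  simp only [mem_supp, eq_iff_iff] at this
  rcases zmod_two_cases (f x) with hf | hf <;> rcases zmod_two_cases (g x) with hg | hg <;>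
    simp_all

theorem supp_eq_empty {f : V → ZMod 2} : supp f = ∅ ↔ f = 0 := by
  constructor
  · intro h
    funext x
    exact notMem_supp.mp (by simp [h])
  · rintro rfl
    ext x
    simp

variable [DecidableEq V]

/-- The indicator function of a finite set. -/
def ind (A : Finset V) : V → ZMod 2 := fun x => if x ∈ A then 1 else 0

@[simp] theorem supp_ind (A : Finset V) : supp (ind A) = A := by
  ext x
  simp [ind]

@[simp] theorem ind_supp (f : V → ZMod 2) : ind (supp f) = f :=
  supp_injective (supp_ind _)

theorem supp_add (f g : V → ZMod 2) : supp (f + g) = symmDiff (supp f) (supp g) := by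
  ext x
  rw [Finset.mem_symmDiff]
  simp only [mem_supp, Pi.add_apply]
  rcases zmod_two_cases (f x) with hf | hf <;> rcases zmod_two_cases (g x) with hg | hg <;>
    simp [hf, hg]

theorem card_symmDiff_add (A B : Finset V) :
    (symmDiff A B).card + 2 * (A ∩ B).card = A.card + B.card := by
  have h1 : symmDiff A B = (A \ B) ∪ (B \ A) := rfl
  rw [h1, Finset.card_union_of_disjoint disjoint_sdiff_sdiff]
  have h2 := Finset.card_sdiff_add_card_inter A B
  have h3 := Finset.card_sdiff_add_card_inter B A
  rw [inter_comm B A] at h3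
  omega

theorem supp_mul (f g : V → ZMod 2) : supp (f * g) = supp f ∩ supp g := by
  ext x
  simp only [mem_supp, Pi.mul_apply, mem_inter]
  rcases zmod_two_cases (f x) with hf | hf <;> rcases zmod_two_cases (g x) with hg | hg <;>
    simp [hf, hg]

end Support

section Derivative

variable {V : Type*} [AddCommGroup V] [Module (ZMod 2) V] [Fintype V] [DecidableEq V]

/-- The points of the support of `f` that stay in it after translation by `a`. -/
def overlap (f : V → ZMod 2) (a : V) : Finset V := (supp f).filter (fun x => f (x + a) = 1)

theorem card_supp_translate (f : V → ZMod 2) (a : V) :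
    (supp (fun x => f (x + a))).card = (supp f).card := by
  refine Finset.card_bij (fun x _ => x + a) ?_ ?_ ?_
  · intro x hx; simpa using hx
  · intro x _ y _ h; exact add_right_cancel h
  · intro y hy; exact ⟨y - a, by simpa using hy, by simp⟩

theorem card_supp_diff (f : V → ZMod 2) (a : V) :
    (supp (diff a f)).card + 2 * (overlap f a).card = 2 * (supp f).card := by
  have h1 : diff a f = (fun x => f (x + a)) + f := rfl
  have h2 : overlap f a = supp (fun x => f (x + a)) ∩ supp f := by
    ext x; simp [overlap, and_comm]
  rw [h1, h2, supp_add, card_symmDiff_add, card_supp_translate]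
  ring

theorem sum_card_overlap (f : V → ZMod 2) :
    ∑ a : V, (overlap f a).card = (supp f).card ^ 2 := by
  simp only [overlap, Finset.card_filter]
  rw [Finset.sum_comm]
  have : ∀ x ∈ supp f, ∑ a : V, (if f (x + a) = 1 then 1 else 0) = (supp f).card := by
    intro x _
    rw [← card_supp_translate f x, supp, Finset.card_filter]
    simp only [add_comm]
  rw [Finset.sum_congr rfl this, Finset.sum_const, smul_eq_mul, sq]

theorem card_le_of_degLT {r : ℕ} {f : V → ZMod 2} (hf : DegLT (r + 1) f) (h0 : f ≠ 0) :
    Fintype.card V ≤ 2 ^ r * (supp f).card := by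
  induction r generalizing f with
  | zero =>
    obtain ⟨x, hx⟩ := Function.ne_iff.mp h0
    have hx1 : f x = 1 := (zmod_two_cases (f x)).resolve_left hx
    have : supp f = univ := by
      ext y
      simp [hf.eq_const y x, hx1]
    simp [this]
  | succ r ih =>
    by_cases h : ∀ a, diff a f = 0
    · have h1 : DegLT 1 f := fun a x => congrFun (h a) x
      exact (ih (h1.mono (by omega)) h0).trans
        (Nat.mul_le_mul_right _ (Nat.pow_le_pow_right (by norm_num) (by omega)))
    · push Not at h
      obtain ⟨a, ha⟩ := h
      have h1 := ih (hf a) ha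
      have h2 := card_supp_diff f a
      calc Fintype.card V ≤ 2 ^ r * (supp (diff a f)).card := h1
        _ ≤ 2 ^ r * (2 * (supp f).card) := Nat.mul_le_mul_left _ (by omega)
        _ = _ := by ring

/-- Translations fixing `f`. -/
def stab (f : V → ZMod 2) : AddSubgroup V where
  carrier := {a | ∀ x, f (x + a) = f x}
  zero_mem' := by simp
  add_mem' := by
    intro a b ha hb x
    rw [← add_assoc, hb, ha]
  neg_mem' := by
    intro a ha x
    rw [← ha (x + -a)]
    simp

theorem mem_stab {f : V → ZMod 2} {a : V} : a ∈ stab f ↔ ∀ x, f (x + a) = f x := Iff.rfl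

theorem diff_eq_zero {f : V → ZMod 2} {a : V} : diff a f = 0 ↔ a ∈ stab f := by
  rw [mem_stab, funext_iff]
  exact forall_congr' fun x => CharTwo.add_eq_zero

theorem card_stab_dvd_card_supp (f : V → ZMod 2) : Nat.card (stab f) ∣ (supp f).card := by
  classical
  have key : ∀ q ∈ (supp f).image (QuotientAddGroup.mk : V → V ⧸ stab f),
      ((supp f).filter (fun x => (QuotientAddGroup.mk x : V ⧸ stab f) = q)).card
        = Nat.card (stab f) := by
    intro q hq
    obtain ⟨p, hp, rfl⟩ := Finset.mem_image.mp hq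
    rw [Nat.card_eq_fintype_card, ← Finset.card_univ]
    symm
    refine Finset.card_bij (fun a _ => p + (a : V)) ?_ ?_ ?_
    · intro a _
      have := a.2 p
      simp only [mem_filter, mem_supp]
      refine ⟨this.trans (mem_supp.mp hp), ?_⟩
      rw [eq_comm, QuotientAddGroup.eq]
      simp
    · intro a _ b _ h
      exact Subtype.ext (add_left_cancel h)
    · intro y hy
      simp only [mem_filter, mem_supp] at hy
      have h := hy.2
      rw [eq_comm, QuotientAddGroup.eq] at h
      exact ⟨⟨_, h⟩, mem_univ _, by simp⟩
  rw [Finset.card_eq_sum_card_image (QuotientAddGroup.mk : V → V ⧸ stab f) (supp f),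
    Finset.sum_congr rfl key, Finset.sum_const, smul_eq_mul]
  exact dvd_mul_left _ _

theorem card_stab_dvd_card (f : V → ZMod 2) : Nat.card (stab f) ∣ Fintype.card V := by
  rw [← Nat.card_eq_fintype_card]
  exact AddSubgroup.card_addSubgroup_dvd_card _

end Derivative

section Flat

variable {V : Type*} [AddCommGroup V] [Module (ZMod 2) V]

/-- A finite set is a flat if it is a nonempty affine subspace over `𝔽₂`. -/
def IsFlat (S : Finset V) : Prop :=
  S.Nonempty ∧ ∀ x ∈ S, ∀ y ∈ S, ∀ z ∈ S, x + y + z ∈ S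

theorem add_self (x : V) : x + x = 0 := ZModModule.add_self x

theorem add_add_cancel (x y : V) : x + y + y = x := by rw [add_assoc, add_self, add_zero]

theorem IsFlat.exists_submodule {S : Finset V} (hS : IsFlat S) {p : V} (hp : p ∈ S) :
    ∃ W : Submodule (ZMod 2) V, ∀ x, x ∈ S ↔ x + p ∈ W := by
  let G : AddSubgroup V :=
    { carrier := {a | a + p ∈ S}
      zero_mem' := by simpa using hp
      add_mem' := by
        intro a b ha hb
        have h := hS.2 _ ha _ hb _ hp
        have e : a + p + (b + p) + p = a + b + p := by
          rw [add_add_add_comm, add_self, add_zero]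
        rwa [e] at h
      neg_mem' := by
        intro a ha
        simpa [ZModModule.neg_eq_self] using ha }
  refine ⟨AddSubgroup.toZModSubmodule 2 G, fun x => ?_⟩
  change _ ↔ x + p + p ∈ S
  rw [add_add_cancel]

theorem IsFlat.inter {S T : Finset V} [DecidableEq V] (hS : IsFlat S) (hT : IsFlat T)
    (h : (S ∩ T).Nonempty) : IsFlat (S ∩ T) := by
  refine ⟨h, fun x hx y hy z hz => ?_⟩
  rw [mem_inter] at *
  exact ⟨hS.2 _ hx.1 _ hy.1 _ hz.1, hT.2 _ hx.2 _ hy.2 _ hz.2⟩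

theorem IsFlat.map {U : Type*} [AddCommGroup U] [Module (ZMod 2) U] [DecidableEq V]
    {S : Finset U} (hS : IsFlat S) (L : U →ₗ[ZMod 2] V) (c : V) :
    IsFlat (S.image (fun y => L y + c)) := by
  refine ⟨hS.1.image _, ?_⟩
  simp only [Finset.mem_image]
  rintro _ ⟨x, hx, rfl⟩ _ ⟨y, hy, rfl⟩ _ ⟨z, hz, rfl⟩
  refine ⟨_, hS.2 _ hx _ hy _ hz, ?_⟩
  rw [map_add, map_add]
  have : L x + c + (L y + c) + (L z + c) = L x + L y + L z + c + (c + c) := by abel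
  rw [this, add_self, add_zero]

theorem card_eq_card_submodule {S : Finset V} {p : V} {W : Submodule (ZMod 2) V}
    (h : ∀ x, x ∈ S ↔ x + p ∈ W) : S.card = Nat.card W := by
  rw [← Nat.card_eq_finsetCard]
  refine Nat.card_congr ⟨fun x => ⟨x + p, (h _).mp x.2⟩, fun w => ⟨w + p, (h _).mpr ?_⟩, ?_, ?_⟩
  · rw [add_add_cancel]; exact w.2
  · intro x; simp [add_add_cancel]
  · intro x; simp [add_add_cancel]

theorem card_submodule [Finite V] (W : Submodule (ZMod 2) V) :
    Nat.card W = 2 ^ Module.finrank (ZMod 2) W := by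
  rw [Module.natCard_eq_pow_finrank (K := ZMod 2), Nat.card_zmod]

theorem IsFlat.card_eq_two_pow [Finite V] {S : Finset V} (hS : IsFlat S) :
    ∃ k, S.card = 2 ^ k := by
  obtain ⟨p, hp⟩ := hS.1
  obtain ⟨W, hW⟩ := hS.exists_submodule hp
  exact ⟨_, (card_eq_card_submodule hW).trans (card_submodule W)⟩

theorem exists_linear_separating {S : Finset V} (hS : IsFlat S) {p q : V} (hp : p ∈ S)
    (hq : q ∉ S) : ∃ φ : V →ₗ[ZMod 2] ZMod 2, ∀ x ∈ S, φ x = φ q + 1 := by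
  obtain ⟨W, hW⟩ := hS.exists_submodule hp
  obtain ⟨φ, h1, h2⟩ := Submodule.exists_le_ker_of_notMem (fun h => hq ((hW q).mpr h))
  refine ⟨φ, fun x hx => ?_⟩
  have h3 : φ (x + p) = 0 := h2 ((hW x).mp hx)
  have h4 : φ (q + p) = 1 := (zmod_two_cases _).resolve_left h1
  rw [map_add] at h3 h4
  revert h3 h4
  generalize φ x = a
  generalize φ p = b
  generalize φ q = c
  clear * -
  revert a b c
  decide

variable [Fintype V] [DecidableEq V]

theorem mem_overlap {f : V → ZMod 2} {a x : V} :
    x ∈ overlap f a ↔ f x = 1 ∧ f (x + a) = 1 := by simp [overlap]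

theorem isFlat_supp_of_card {r : ℕ} {f : V → ZMod 2} (hf : DegLT (r + 1) f) (h0 : f ≠ 0)
    (hc : 2 ^ r * (supp f).card ≤ Fintype.card V) : IsFlat (supp f) := by
  refine ⟨Finset.nonempty_iff_ne_empty.mpr (fun h => h0 (supp_eq_empty.mp h)), ?_⟩
  simp only [mem_supp]
  intro x hx y hy z hz
  have key : diff (y + z) f = 0 := by
    cases r with
    | zero => exact funext (hf (y + z))
    | succ r =>
      by_contra hne
      have h1 := card_le_of_degLT (hf (y + z)) hne
      have h2 := card_supp_diff f (y + z)
      have h3 : 0 < (overlap f (y + z)).card := by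
        refine Finset.card_pos.mpr ⟨y, mem_overlap.mpr ⟨hy, ?_⟩⟩
        rwa [← add_assoc, add_self, zero_add]
      have h4 : 2 ^ (r + 1) * (supp f).card ≤ 2 ^ r * (supp (diff (y + z) f)).card := by omega
      rw [pow_succ, mul_assoc] at h4
      have := Nat.le_of_mul_le_mul_left h4 (by positivity)
      omega
  rw [diff_eq_zero] at key
  rw [add_assoc, key x, hx]

theorem mem_image_add_right {A : Finset V} {a x : V} : x ∈ A.image (· + a) ↔ x + a ∈ A := by
  simp only [Finset.mem_image]
  constructor
  · rintro ⟨y, hy, rfl⟩; rwa [add_add_cancel]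
  · intro h; exact ⟨_, h, add_add_cancel _ _⟩

theorem IsFlat.union_translate {A : Finset V} (hA : IsFlat A) (a : V) :
    IsFlat (A ∪ A.image (· + a)) := by
  obtain ⟨p, hp⟩ := hA.1
  have hfl : ∀ x ∈ A, ∀ y ∈ A, ∀ z ∈ A, x + y + z ∈ A := hA.2
  refine ⟨⟨p, mem_union_left _ hp⟩, ?_⟩
  intro x hx y hy z hz
  simp only [mem_union, mem_image_add_right] at *
  rcases hx with hx | hx <;> rcases hy with hy | hy <;> rcases hz with hz | hz
  · exact Or.inl (hfl _ hx _ hy _ hz)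
  all_goals
    have h := hfl _ hx _ hy _ hz
    first
    | (right; convert h using 1; abel; done)
    | (left; convert h using 1; rw [← add_add_cancel (x + y + z) a]; abel; done)
    | (right; convert h using 1; rw [← add_add_cancel (x + y + z) a]; abel)

theorem degLT_ind {k : ℕ} {A : Finset V} (hA : IsFlat A) (hc : Fintype.card V = 2 ^ k * A.card) :
    DegLT (k + 1) (ind A) := by
  induction k generalizing A with
  | zero =>
    have : A = univ := by rw [← Finset.card_eq_iff_eq_univ]; omega
    subst this
    convert degLT_const (V := V) 1 using 1
    funext x
    simp [ind]
  | succ k ih =>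
    intro a
    obtain ⟨p, hp⟩ := hA.1
    obtain ⟨W, hW⟩ := hA.exists_submodule hp
    by_cases ha : a ∈ W
    · have : diff a (ind A) = 0 := by
        rw [diff_eq_zero, mem_stab]
        intro x
        have : x + a ∈ A ↔ x ∈ A := by
          rw [hW, hW, add_right_comm, Submodule.add_mem_iff_left _ ha]
        simp [ind, this]
      rw [this]
      exact degLT_zero _
    · have hmem : ∀ x, x + a ∈ A ↔ x + p + a ∈ W := by
        intro x; rw [hW, add_right_comm]
      have hnot : ∀ x, x ∈ A → x + a ∉ A := by
        intro x hx h
        rw [hmem] at h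
        exact ha ((Submodule.add_mem_iff_right _ ((hW x).mp hx)).mp h)
      let B := A.image (· + a)
      have hB : ∀ x, x ∈ B ↔ x + a ∈ A := fun x => mem_image_add_right
      have hdisj : Disjoint A B := by
        rw [Finset.disjoint_left]
        intro x hx hxB
        exact hnot x hx ((hB x).mp hxB)
      have hcard : (A ∪ B).card = 2 * A.card := by
        rw [Finset.card_union_of_disjoint hdisj,
          Finset.card_image_of_injective _ (add_left_injective a)]
        ring
      have hflat : IsFlat (A ∪ B) := hA.union_translate a
      have heq : diff a (ind A) = ind (A ∪ B) := by
        funext x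
        simp only [diff, ind, mem_union, hB]
        by_cases h1 : x ∈ A
        · simp [h1, hnot x h1]
        · by_cases h2 : x + a ∈ A <;> simp [h1, h2]
      rw [heq]
      exact ih hflat (by rw [hc, hcard]; ring)

theorem card_ge_of_inter_half {r : ℕ} {f : V → ZMod 2} (hf : DegLT (r + 1) f)
    (φ : V →ₗ[ZMod 2] ZMod 2) (c : ZMod 2) {q : V} (hq : f q = 1) (hφ : φ q = c + 1) :
    Fintype.card V ≤ 2 ^ (r + 1) * ((supp f).filter (fun x => φ x = c + 1)).card := by
  have h1 := hf.mul (degLT_linear φ c)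
  have h2 : supp (f * fun x => φ x + c) = (supp f).filter (fun x => φ x = c + 1) := by
    ext x
    rw [supp_mul]
    simp only [mem_inter, mem_supp, mem_filter, and_congr_right_iff]
    intro _
    generalize φ x = t
    clear * -
    revert t c
    decide
  rw [← h2]
  refine card_le_of_degLT (r := r + 1) h1 ?_
  intro h
  have : q ∈ supp (f * fun x => φ x + c) := by rw [h2]; simp [hq, hφ]
  rw [h] at this
  simp at this

theorem card_gap {r d : ℕ} {f : V → ZMod 2} (hf : DegLT (r + 1) f)
    (hV : Fintype.card V = 2 ^ r * d) (hd : d < (supp f).card) :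
    3 * d ≤ 2 * (supp f).card := by
  induction r generalizing f d with
  | zero =>
    have := Finset.card_le_univ (supp f)
    omega
  | succ r ih =>
    by_contra! hlt
    have hder : ∀ a, diff a f = 0 ∨ (supp (diff a f)).card = 2 * d := by
      intro a
      by_cases h0 : diff a f = 0
      · exact Or.inl h0
      right
      have h1 := card_le_of_degLT (hf a) h0
      have h2 := card_supp_diff f a
      rw [hV, pow_succ, mul_assoc] at h1
      have h3 := Nat.le_of_mul_le_mul_left h1 (by positivity)
      by_contra h4
      have := ih (d := 2 * d) (hf a) (by rw [hV]; ring) (by omega)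
      omega
    by_cases hall : ∀ a, diff a f = 0
    · have h1 : DegLT 1 f := fun a x => congrFun (hall a) x
      have h0 : f ≠ 0 := by
        rintro rfl
        have : supp (0 : V → ZMod 2) = ∅ := supp_eq_empty.mpr rfl
        simp [this] at hd
      have h2 := card_le_of_degLT (r := 0) h1 h0
      rw [hV, pow_succ] at h2
      have : 1 ≤ 2 ^ r := Nat.one_le_two_pow
      nlinarith
    · push Not at hall
      obtain ⟨a, ha⟩ := hall
      have hca := (hder a).resolve_left ha
      have h2 := card_supp_diff f a
      have hflat := isFlat_supp_of_card (hf a) ha (by rw [hca, hV]; apply le_of_eq; ring)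
      obtain ⟨p0, hp0⟩ := hflat.1
      obtain ⟨q, hq⟩ : (overlap f a).Nonempty := by rw [← Finset.card_pos]; omega
      rw [mem_overlap] at hq
      have hqC : q ∉ supp (diff a f) := by
        rw [notMem_supp, diff, hq.1, hq.2]; rfl
      obtain ⟨φ, hφ⟩ := exists_linear_separating hflat hp0 hqC
      have h3 := card_ge_of_inter_half hf φ (φ q + 1) hq.1
        (by rw [add_assoc, CharTwo.add_self_eq_zero, add_zero])
      have h4 : (supp f).filter (fun x => φ x = φ q + 1 + 1) ⊆ overlap f a := by
        intro x hx
        rw [mem_filter, mem_supp] at hx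
        refine mem_overlap.mpr ⟨hx.1, ?_⟩
        have : x ∉ supp (diff a f) := by
          intro h
          have := (hφ x h).symm.trans hx.2
          simp at this
        rw [notMem_supp, diff, CharTwo.add_eq_zero] at this
        rw [this, hx.1]
      have h5 := Finset.card_le_card h4
      have h6 : 2 ^ (r + 1) * d ≤ 2 ^ (r + 1) * (2 * (overlap f a).card) := by
        rw [← hV]
        refine h3.trans ?_
        rw [pow_succ 2 (r + 1), mul_assoc]
        gcongr
      have := Nat.le_of_mul_le_mul_left h6 (by positivity)
      omega

end Flat

section LowWeight

variable {V : Type*} [AddCommGroup V] [Module (ZMod 2) V]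

/-- `f` is a multiple of a nonconstant affine form. -/
def Divisible (f : V → ZMod 2) : Prop :=
  ∃ φ : V →ₗ[ZMod 2] ZMod 2, φ ≠ 0 ∧ ∃ c, ∀ x, f x = 1 → φ x = c

variable [Fintype V] [DecidableEq V]

theorem sq_card_le_of_overlap_le {f : V → ZMod 2} {M : ℕ}
    (h : ∀ a, a ∉ stab f → 2 * (overlap f a).card ≤ M) :
    2 * (supp f).card ^ 2 + M * Nat.card (stab f) ≤
      2 * (supp f).card * Nat.card (stab f) + M * Fintype.card V := by
  classical
  have hL : (univ.filter (fun a => a ∈ stab f)).card = Nat.card (stab f) := by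
    rw [Nat.card_eq_fintype_card, Fintype.card_subtype]
  have h1 : ∀ a, 2 * (overlap f a).card + (if a ∈ stab f then M else 0) ≤
      (if a ∈ stab f then 2 * (supp f).card else 0) + M := by
    intro a
    split_ifs with ha
    · have : (overlap f a).card ≤ (supp f).card := Finset.card_filter_le _ _
      omega
    · have := h a ha
      omega
  have h2 := Finset.sum_le_sum (fun a (_ : a ∈ (univ : Finset V)) => h1 a)
  rw [Finset.sum_add_distrib, Finset.sum_add_distrib, ← Finset.mul_sum, sum_card_overlap,
    ← Finset.sum_filter, ← Finset.sum_filter, Finset.sum_const, Finset.sum_const, hL,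
    Finset.sum_const, Finset.card_univ, smul_eq_mul, smul_eq_mul, smul_eq_mul] at h2
  linarith

theorem card_diff_ge {r d : ℕ} {f : V → ZMod 2} (hf : DegLT (r + 2) f)
    (hV : Fintype.card V = 2 ^ (r + 1) * d) {a : V} (ha : a ∉ stab f)
    (hne : (supp (diff a f)).card ≠ 2 * d) : 3 * d ≤ (supp (diff a f)).card := by
  have h1 := card_le_of_degLT (hf a) (fun h => ha (diff_eq_zero.mp h))
  rw [hV, pow_succ, mul_assoc] at h1
  have h2 := Nat.le_of_mul_le_mul_left h1 (by positivity)
  have h3 := card_gap (d := 2 * d) (hf a) (by rw [hV]; ring) (by omega)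
  omega

theorem exists_projection {C : Finset V} (hC : IsFlat C) {s : ℕ}
    (hV : Fintype.card V = 2 ^ s * C.card) :
    ∃ π : V →ₗ[ZMod 2] (Fin s → ZMod 2), Function.Surjective π ∧
      ∃ c, ∀ x, x ∈ C ↔ π x + c = 0 := by
  obtain ⟨p, hp⟩ := hC.1
  obtain ⟨W, hW⟩ := hC.exists_submodule hp
  have hpos : 0 < C.card := Finset.card_pos.mpr hC.1
  have hr : Module.finrank (ZMod 2) (V ⧸ W) = Module.finrank (ZMod 2) (Fin s → ZMod 2) := by
    rw [Module.finrank_fin_fun]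
    have h1 := card_submodule (⊤ : Submodule (ZMod 2) V)
    have h2 := card_submodule W
    have h3 := Submodule.finrank_quotient_add_finrank W
    have h4 : Nat.card (⊤ : Submodule (ZMod 2) V) = Fintype.card V := by
      rw [← Nat.card_eq_fintype_card]
      exact Nat.card_congr (Submodule.topEquiv (R := ZMod 2) (M := V)).toEquiv
    rw [h4, finrank_top, hV, card_eq_card_submodule hW, h2, ← pow_add] at h1
    have := Nat.pow_right_injective le_rfl h1
    omega
  let e := LinearEquiv.ofFinrankEq _ _ hr
  refine ⟨e.toLinearMap ∘ₗ W.mkQ, e.surjective.comp W.mkQ_surjective,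
    e (W.mkQ p), fun x => ?_⟩
  rw [hW, ← Submodule.Quotient.mk_eq_zero]
  simp only [LinearMap.comp_apply, LinearEquiv.coe_coe, ← map_add,
    LinearEquiv.map_eq_zero_iff]
  rfl

/-- The linear form `x ↦ u ⬝ᵥ π x`. -/
def dotForm {s : ℕ} (π : V →ₗ[ZMod 2] (Fin s → ZMod 2)) (u : Fin s → ZMod 2) :
    V →ₗ[ZMod 2] ZMod 2 where
  toFun x := u ⬝ᵥ π x
  map_add' x y := by rw [map_add, dotProduct_add]
  map_smul' c x := by rw [map_smul, dotProduct_smul, RingHom.id_apply]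

theorem dotForm_ne_zero {s : ℕ} {π : V →ₗ[ZMod 2] (Fin s → ZMod 2)}
    (hπ : Function.Surjective π) {u : Fin s → ZMod 2} (hu : u ≠ 0) : dotForm π u ≠ 0 := by
  intro h
  refine hu (funext fun i => ?_)
  obtain ⟨x, hx⟩ := hπ (Pi.single i 1)
  have := LinearMap.congr_fun h x
  simpa [dotForm, hx] using this

/-- The points of the support of `f` on which `u ⬝ᵥ ρ x = 1`. -/
def half {s : ℕ} (f : V → ZMod 2) (ρ : V → Fin s → ZMod 2) (u : Fin s → ZMod 2) : Finset V :=
  (supp f).filter (fun x => u ⬝ᵥ ρ x = 1)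

theorem mem_half {s : ℕ} {f : V → ZMod 2} {ρ : V → Fin s → ZMod 2} {u : Fin s → ZMod 2} {x : V} :
    x ∈ half f ρ u ↔ f x = 1 ∧ u ⬝ᵥ ρ x = 1 := by simp [half]

theorem supp_mul_dot {s : ℕ} (f : V → ZMod 2) (ρ : V → Fin s → ZMod 2) (u : Fin s → ZMod 2) :
    supp (f * fun x => u ⬝ᵥ ρ x) = half f ρ u := by
  ext x
  rw [supp_mul, mem_half]
  simp

theorem degLT_mul_dot {s k : ℕ} {f : V → ZMod 2} (hf : DegLT k f)
    (π : V →ₗ[ZMod 2] (Fin s → ZMod 2)) (c u : Fin s → ZMod 2) :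
    DegLT (k + 1) (f * fun x => u ⬝ᵥ (π x + c)) := by
  have h := hf.mul (degLT_linear (dotForm π u) (u ⬝ᵥ c))
  change DegLT (k + 1) _ at h
  convert h using 1
  funext x
  simp [dotForm, dotProduct_add]

/-- The coordinates attached to a derivative of minimal weight: outside the support of the
derivative every affine hyperplane section of the support of `f` is large. -/
theorem exists_coordinates {s d : ℕ} {f : V → ZMod 2} (hf : DegLT (s + 2) f)
    (hV : Fintype.card V = 2 ^ (s + 1) * d) (hd : 0 < d) (hdiv : ¬ Divisible f) {a : V}
    (ha : (supp (diff a f)).card = 2 * d) :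
    ∃ (π : V →ₗ[ZMod 2] (Fin s → ZMod 2)) (c : Fin s → ZMod 2),
      (∀ x, x ∈ overlap f a ↔ f x = 1 ∧ π x + c ≠ 0) ∧
      ∀ u ≠ 0, d ≤ 2 * (half f (fun x => π x + c) u).card := by
  have hne : diff a f ≠ 0 := by
    intro h
    have := supp_eq_empty.mpr h
    rw [this, card_empty] at ha
    omega
  have hflat := isFlat_supp_of_card (hf a) hne (by rw [ha, hV]; apply le_of_eq; ring)
  obtain ⟨π, hπ, c, hc⟩ := exists_projection (s := s) hflat (by rw [hV, ha]; ring)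
  refine ⟨π, c, fun x => ?_, fun u hu => ?_⟩
  · rw [mem_overlap, Ne, ← hc, notMem_supp, diff, CharTwo.add_eq_zero]
    constructor
    · rintro ⟨h1, h2⟩; exact ⟨h1, by rw [h1, h2]⟩
    · rintro ⟨h1, h2⟩; exact ⟨h1, by rw [h2, h1]⟩
  · have h1 := card_le_of_degLT (degLT_mul_dot hf π c u) ?_
    · rw [supp_mul_dot, hV, pow_succ 2 (s + 1), mul_assoc] at h1
      exact Nat.le_of_mul_le_mul_left h1 (by positivity)
    · intro h0
      refine hdiv ⟨dotForm π u, dotForm_ne_zero hπ hu, u ⬝ᵥ c, fun x hx => ?_⟩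
      have := congrFun h0 x
      simp only [Pi.mul_apply, hx, one_mul, Pi.zero_apply, dotProduct_add] at this
      exact CharTwo.add_eq_zero.mp this

theorem sum_card_half {s : ℕ} (f : V → ZMod 2) (ρ : V → Fin s → ZMod 2) {T : Finset V}
    (hT : ∀ x, x ∈ T ↔ f x = 1 ∧ ρ x ≠ 0) (P : Finset (Fin s → ZMod 2)) :
    ∑ u ∈ P, (half f ρ u).card = ∑ x ∈ T, (P.filter (fun u => u ⬝ᵥ ρ x = 1)).card := by
  have h : ∀ u, half f ρ u = T.filter (fun x => u ⬝ᵥ ρ x = 1) := by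
    intro u
    ext x
    rw [mem_half, mem_filter, hT]
    constructor
    · rintro ⟨h1, h2⟩
      exact ⟨⟨h1, fun h => by simp [h] at h2⟩, h2⟩
    · rintro ⟨⟨h1, _⟩, h2⟩; exact ⟨h1, h2⟩
  simp only [h, Finset.card_filter]
  exact Finset.sum_comm

/-- A large flat inside the support, glued from the hyperplane sections. -/
theorem exists_flat_of_halves {s m : ℕ} {f : V → ZMod 2} {ρ : V → Fin s → ZMod 2}
    (hm : 0 < m)
    (hflat : ∀ u ≠ 0, IsFlat (half f ρ u)) (hcard : ∀ u ≠ 0, (half f ρ u).card = 16)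
    (haff : ∀ x y z, ρ (x + y + z) = ρ x + ρ y + ρ z)
    (hfib : ∀ v ≠ 0, ((supp f).filter (fun x => ρ x = v)).card = m)
    (hdec : ∃ u₀ e₀ e₁ : Fin s → ZMod 2, u₀ ⬝ᵥ e₀ = 1 ∧ u₀ ⬝ᵥ e₁ = 0 ∧ e₁ ≠ 0 ∧
      ∀ u, u₀ ⬝ᵥ u = 1 → u ≠ e₀ + e₁ →
        ∃ φ : Fin s → ZMod 2, φ ⬝ᵥ u = 1 ∧ φ ⬝ᵥ e₀ = 1 ∧ φ ⬝ᵥ e₁ = 1) :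
    ∃ A : Finset V, IsFlat A ∧ A.card = 32 ∧ 32 ≤ (A ∩ supp f).card + m := by
  obtain ⟨u₀, e₀, e₁, h0, h1, he1, hφ⟩ := hdec
  have hu0 : u₀ ≠ 0 := by rintro rfl; simp at h0
  have he0 : e₀ ≠ 0 := by rintro rfl; simp at h0
  have he01 : e₀ + e₁ ≠ 0 := by
    intro h
    have : u₀ ⬝ᵥ (e₀ + e₁) = 0 := by rw [h, dotProduct_zero]
    rw [dotProduct_add, h0, h1] at this
    simp at this
  obtain ⟨x₀, hx₀⟩ : ((supp f).filter (fun x => ρ x = e₀)).Nonempty := by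
    rw [← Finset.card_pos, hfib _ he0]; exact hm
  obtain ⟨q, hq⟩ : ((supp f).filter (fun x => ρ x = e₁)).Nonempty := by
    rw [← Finset.card_pos, hfib _ he1]; exact hm
  simp only [mem_filter, mem_supp] at hx₀ hq
  set F := half f ρ u₀ with hF
  set t := q + x₀ with ht
  have htr : ∀ y, ρ (y + t) = ρ y + e₁ + e₀ := by
    intro y
    rw [ht, ← add_assoc, haff, hq.2, hx₀.2]
  have hdot : ∀ y, u₀ ⬝ᵥ ρ (y + t) = u₀ ⬝ᵥ ρ y + 1 := by
    intro y
    rw [htr, dotProduct_add, dotProduct_add, h0, h1, add_zero]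
  have hdisj : Disjoint F (F.image (· + t)) := by
    rw [Finset.disjoint_left]
    intro x hx hx'
    rw [mem_image_add_right] at hx'
    have a1 := (mem_half.mp hx).2
    have a2 := (mem_half.mp hx').2
    rw [hdot, a1] at a2
    exact absurd a2 (by decide)
  have hcardF : F.card = 16 := hcard _ hu0
  refine ⟨F ∪ F.image (· + t), (hflat _ hu0).union_translate t, ?_, ?_⟩
  · rw [card_union_of_disjoint hdisj, card_image_of_injective _ (add_left_injective t), hcardF]
  · let G := F.filter (fun y => ρ y ≠ e₀ + e₁)
    have hsub : F ∪ G.image (· + t) ⊆ (F ∪ F.image (· + t)) ∩ supp f := by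
      intro x hx
      rw [mem_inter]
      rcases mem_union.mp hx with hx | hx
      · exact ⟨mem_union_left _ hx, mem_supp.mpr (mem_half.mp hx).1⟩
      · refine ⟨mem_union_right _ (image_subset_image (filter_subset _ _) hx), ?_⟩
        obtain ⟨y, hy, rfl⟩ := Finset.mem_image.mp hx
        rw [mem_filter, hF, mem_half] at hy
        obtain ⟨φ, b1, b2, b3⟩ := hφ _ hy.1.2 hy.2
        have hφ0 : φ ≠ 0 := by rintro rfl; simp at b2
        have := (hflat φ hφ0).2 y (mem_half.mpr ⟨hy.1.1, b1⟩) q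
          (mem_half.mpr ⟨hq.1, by rw [hq.2, b3]⟩) x₀ (mem_half.mpr ⟨hx₀.1, by rw [hx₀.2, b2]⟩)
        rw [ht, ← add_assoc]
        exact mem_supp.mpr (mem_half.mp this).1
    have hG : G.card + m = 16 := by
      have e : F.filter (fun y => ρ y = e₀ + e₁) = (supp f).filter (fun x => ρ x = e₀ + e₁) := by
        ext x
        simp only [mem_filter, hF, mem_half, mem_supp]
        constructor
        · rintro ⟨⟨a1, _⟩, a2⟩; exact ⟨a1, a2⟩
        · rintro ⟨a1, a2⟩
          exact ⟨⟨a1, by rw [a2, dotProduct_add, h0, h1, add_zero]⟩, a2⟩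
      have := Finset.card_filter_add_card_filter_not (s := F) (fun y => ρ y = e₀ + e₁)
      rw [e, hfib _ he01, hcardF] at this
      change (F.filter (fun y => ¬ ρ y = e₀ + e₁)).card + m = 16
      omega
    have h3 := Finset.card_le_card hsub
    rw [card_union_of_disjoint, card_image_of_injective _ (add_left_injective t), hcardF] at h3
    · omega
    · exact hdisj.mono_right (image_subset_image (filter_subset _ _))

theorem eq_add_ind_of_inter {r : ℕ} {f : V → ZMod 2} (hf : DegLT (r + 1) f)
    (hV : Fintype.card V = 2 ^ r * 32) {A : Finset V} (hA : IsFlat A) (hcA : A.card = 32)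
    (hne : (supp f).card ≠ 32) (hlt : (supp f).card + 32 < 48 + 2 * (A ∩ supp f).card) :
    ∃ B : Finset V, IsFlat B ∧ B.card = 32 ∧ f = ind A + ind B := by
  have hg : DegLT (r + 1) (f + ind A) := hf.add (degLT_ind hA (by rw [hV, hcA]))
  have h1 : (supp (f + ind A)).card + 2 * (supp f ∩ A).card = (supp f).card + 32 := by
    rw [supp_add, supp_ind, card_symmDiff_add, hcA]
  rw [inter_comm] at h1
  have h0 : f + ind A ≠ 0 := by
    intro h
    have : f = ind A := by
      funext x
      have := congrFun h x
      exact CharTwo.add_eq_zero.mp this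
    rw [this, supp_ind] at hne
    exact hne hcA
  have h2 := card_le_of_degLT hg h0
  rw [hV] at h2
  have h3 := Nat.le_of_mul_le_mul_left h2 (by positivity)
  have h4 : (supp (f + ind A)).card = 32 := by
    by_contra hne'
    have := card_gap hg hV (by omega)
    omega
  refine ⟨supp (f + ind A), isFlat_supp_of_card hg h0 (by rw [h4, hV]), h4, ?_⟩
  rw [ind_supp]
  funext x
  simp only [Pi.add_apply]
  linear_combination -(CharTwo.add_self_eq_zero (ind A x))

theorem card_stab_le {n w : ℕ} {f : V → ZMod 2} (hV : Fintype.card V = n)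
    (hw : (supp f).card = w) (hpos : 0 < Nat.gcd w n) : Nat.card (stab f) ≤ Nat.gcd w n :=
  Nat.le_of_dvd hpos (Nat.dvd_gcd (hw ▸ card_stab_dvd_card_supp f) (hV ▸ card_stab_dvd_card f))

end LowWeight

section Classification

variable {V : Type*} [AddCommGroup V] [Module (ZMod 2) V] [Fintype V] [DecidableEq V]

theorem exists_card_diff_eq {r d l : ℕ} {f : V → ZMod 2} (hf : DegLT (r + 2) f)
    (hV : Fintype.card V = 2 ^ (r + 1) * d) (hl : Nat.card (stab f) ≤ l)
    (h : 3 * d * l + (2 * (supp f).card - 3 * d) * Fintype.card V < 2 * (supp f).card ^ 2)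
    (hd : 3 * d ≤ 2 * (supp f).card) :
    ∃ a, (supp (diff a f)).card = 2 * d := by
  by_contra! hne
  have h1 := sq_card_le_of_overlap_le (f := f) (M := 2 * (supp f).card - 3 * d) (fun a ha => by
    have := card_diff_ge hf hV ha (hne a)
    have := card_supp_diff f a
    omega)
  obtain ⟨m, hm⟩ := Nat.exists_eq_add_of_le hd
  rw [hm, Nat.add_sub_cancel_left] at h h1
  nlinarith

theorem card_dot_eq_one_two : ∀ v : Fin 2 → ZMod 2, v ≠ 0 →
    ((univ.filter (fun u : Fin 2 → ZMod 2 => u ≠ 0)).filter (fun u => u ⬝ᵥ v = 1)).card = 2 := by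
  decide

theorem card_dot_eq_one_three : ∀ v : Fin 3 → ZMod 2, v ≠ 0 →
    ((univ.filter (fun u : Fin 3 → ZMod 2 => u ≠ 0)).filter (fun u => u ⬝ᵥ v = 1)).card = 4 := by
  decide

theorem card_dot_eq_one_pair_two : ∀ v : Fin 2 → ZMod 2, v ≠ 0 → ∀ w, w ≠ 0 →
    ((univ.filter (fun u : Fin 2 → ZMod 2 => u ⬝ᵥ v = 1)).filter (fun u => u ⬝ᵥ w = 1)).card =
      1 * (1 + if w = v then 1 else 0) := by
  decide

theorem card_dot_eq_one_pair_three : ∀ v : Fin 3 → ZMod 2, v ≠ 0 → ∀ w, w ≠ 0 →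
    ((univ.filter (fun u : Fin 3 → ZMod 2 => u ⬝ᵥ v = 1)).filter (fun u => u ⬝ᵥ w = 1)).card =
      2 * (1 + if w = v then 1 else 0) := by
  decide

theorem exists_flags_two : ∃ u₀ e₀ e₁ : Fin 2 → ZMod 2, u₀ ⬝ᵥ e₀ = 1 ∧ u₀ ⬝ᵥ e₁ = 0 ∧ e₁ ≠ 0 ∧
      ∀ u, u₀ ⬝ᵥ u = 1 → u ≠ e₀ + e₁ →
        ∃ φ : Fin 2 → ZMod 2, φ ⬝ᵥ u = 1 ∧ φ ⬝ᵥ e₀ = 1 ∧ φ ⬝ᵥ e₁ = 1 :=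
  ⟨Pi.single 0 1, Pi.single 0 1, Pi.single 1 1, by decide⟩

theorem exists_flags_three : ∃ u₀ e₀ e₁ : Fin 3 → ZMod 2, u₀ ⬝ᵥ e₀ = 1 ∧ u₀ ⬝ᵥ e₁ = 0 ∧ e₁ ≠ 0 ∧
      ∀ u, u₀ ⬝ᵥ u = 1 → u ≠ e₀ + e₁ →
        ∃ φ : Fin 3 → ZMod 2, φ ⬝ᵥ u = 1 ∧ φ ⬝ᵥ e₀ = 1 ∧ φ ⬝ᵥ e₁ = 1 :=
  ⟨Pi.single 0 1, Pi.single 0 1, Pi.single 1 1, by decide⟩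

set_option synthInstance.maxSize 1024 in
set_option synthInstance.maxHeartbeats 200000 in
theorem dot_eq_one_or : ∀ u : Fin 2 → ZMod 2, u ≠ 0 → ∀ u', u' ≠ 0 → u ≠ u' →
    ∀ w, w ≠ 0 ↔ u ⬝ᵥ w = 1 ∨ u' ⬝ᵥ w = 1 := by
  decide

theorem sum_card_half_ne_zero {s k : ℕ} (f : V → ZMod 2) (ρ : V → Fin s → ZMod 2) {T : Finset V}
    (hT : ∀ x, x ∈ T ↔ f x = 1 ∧ ρ x ≠ 0)
    (hdec : ∀ v : Fin s → ZMod 2, v ≠ 0 →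
      ((univ.filter (fun u : Fin s → ZMod 2 => u ≠ 0)).filter (fun u => u ⬝ᵥ v = 1)).card = k) :
    ∑ u ∈ univ.filter (fun u : Fin s → ZMod 2 => u ≠ 0), (half f ρ u).card = T.card * k := by
  rw [sum_card_half f ρ hT, Finset.sum_congr rfl (fun x hx => hdec _ ((hT x).mp hx).2),
    Finset.sum_const, smul_eq_mul]

theorem sum_card_half_fiber {s k : ℕ} (f : V → ZMod 2) (ρ : V → Fin s → ZMod 2) {T : Finset V}
    (hT : ∀ x, x ∈ T ↔ f x = 1 ∧ ρ x ≠ 0)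
    (hdec : ∀ v : Fin s → ZMod 2, v ≠ 0 → ∀ w, w ≠ 0 →
      ((univ.filter (fun u : Fin s → ZMod 2 => u ⬝ᵥ v = 1)).filter (fun u => u ⬝ᵥ w = 1)).card =
        k * (1 + if w = v then 1 else 0)) {v : Fin s → ZMod 2} (hv : v ≠ 0) :
    ∑ u ∈ univ.filter (fun u : Fin s → ZMod 2 => u ⬝ᵥ v = 1), (half f ρ u).card =
      k * (T.card + ((supp f).filter (fun x => ρ x = v)).card) := by
  rw [sum_card_half f ρ hT, Finset.sum_congr rfl (fun x hx => hdec v hv _ ((hT x).mp hx).2),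
    ← Finset.mul_sum, Finset.sum_add_distrib, Finset.sum_const, smul_eq_mul, mul_one,
    ← Finset.card_filter]
  congr 3
  ext x
  simp only [mem_filter, hT, mem_supp]
  constructor
  · rintro ⟨⟨h1, _⟩, h2⟩; exact ⟨h1, h2⟩
  · rintro ⟨h1, h2⟩; exact ⟨⟨h1, h2 ▸ hv⟩, h2⟩

theorem card_overlap_of_card_diff {d : ℕ} {f : V → ZMod 2} {a : V}
    (ha : (supp (diff a f)).card = 2 * d) : (overlap f a).card + d = (supp f).card := by
  have := card_supp_diff f a
  omega

theorem sum_filter_ne_zero_two (h : (Fin 2 → ZMod 2) → ℕ) :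
    ∑ u ∈ univ.filter (fun u : Fin 2 → ZMod 2 => u ≠ 0), h u = h ![0, 1] + h ![1, 0] + h ![1, 1] := by
  have : univ.filter (fun u : Fin 2 → ZMod 2 => u ≠ 0) = {![0, 1], ![1, 0], ![1, 1]} := by decide
  rw [this, Finset.sum_insert (by decide), Finset.sum_pair (by decide), add_assoc]

theorem exists_flat_of_card_half {s r k m : ℕ} {f : V → ZMod 2} (hf : DegLT (r + 1) f)
    (hV : Fintype.card V = 2 ^ (r + 1) * 16) (π : V →ₗ[ZMod 2] (Fin s → ZMod 2))
    (c : Fin s → ZMod 2) {T : Finset V} (hT : ∀ x, x ∈ T ↔ f x = 1 ∧ π x + c ≠ 0)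
    (hcard : ∀ u ≠ 0, (half f (fun x => π x + c) u).card = 16) (hk : 0 < k)
    (hn : ∀ v : Fin s → ZMod 2, v ≠ 0 →
      (univ.filter (fun u : Fin s → ZMod 2 => u ⬝ᵥ v = 1)).card * 16 = k * (T.card + m))
    (hm : 0 < m)
    (hdec : ∀ v : Fin s → ZMod 2, v ≠ 0 → ∀ w, w ≠ 0 →
      ((univ.filter (fun u : Fin s → ZMod 2 => u ⬝ᵥ v = 1)).filter (fun u => u ⬝ᵥ w = 1)).card =
        k * (1 + if w = v then 1 else 0))
    (hflag : ∃ u₀ e₀ e₁ : Fin s → ZMod 2, u₀ ⬝ᵥ e₀ = 1 ∧ u₀ ⬝ᵥ e₁ = 0 ∧ e₁ ≠ 0 ∧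
      ∀ u, u₀ ⬝ᵥ u = 1 → u ≠ e₀ + e₁ →
        ∃ φ : Fin s → ZMod 2, φ ⬝ᵥ u = 1 ∧ φ ⬝ᵥ e₀ = 1 ∧ φ ⬝ᵥ e₁ = 1) :
    ∃ A : Finset V, IsFlat A ∧ A.card = 32 ∧ 32 ≤ (A ∩ supp f).card + m := by
  refine exists_flat_of_halves (ρ := fun x => π x + c) hm (fun u hu => ?_) hcard ?_ ?_ hflag
  · rw [← supp_mul_dot]
    refine isFlat_supp_of_card (r := r + 1) (degLT_mul_dot hf π c u) ?_ ?_
    · intro h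
      have := hcard u hu
      rw [← supp_mul_dot, supp_eq_empty.mpr h, card_empty] at this
      omega
    · rw [supp_mul_dot, hcard u hu, hV]
  · intro x y z
    simp only [map_add]
    linear_combination (norm := module) - add_self c
  · intro v hv
    have h1 := sum_card_half_fiber f (fun x => π x + c) hT hdec hv
    rw [Finset.sum_congr rfl (fun u hu => hcard u ?_), Finset.sum_const, smul_eq_mul, hn v hv] at h1
    · have := Nat.eq_of_mul_eq_mul_left hk h1
      omega
    · rintro rfl
      simp at hu

theorem card_dot_two : ∀ v : Fin 2 → ZMod 2, v ≠ 0 →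
    (univ.filter (fun u : Fin 2 → ZMod 2 => u ⬝ᵥ v = 1)).card = 2 := by decide

theorem card_dot_three : ∀ v : Fin 3 → ZMod 2, v ≠ 0 →
    (univ.filter (fun u : Fin 3 → ZMod 2 => u ⬝ᵥ v = 1)).card = 4 := by decide

/-- Cubic forms of weight between the minimal distance and `7/4` of it, in dimension nine. -/
theorem divisible_of_card_lt {f : V → ZMod 2} (hf : DegLT 4 f) (hV : Fintype.card V = 512)
    (h1 : 64 < (supp f).card) (h2 : (supp f).card < 112) : Divisible f := by
  by_contra hdiv
  have hl : Nat.card (stab f) ≤ 32 := by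
    have a1 := card_stab_dvd_card_supp f
    have a2 := card_stab_dvd_card f
    rw [hV] at a2
    obtain ⟨j, hj, a3⟩ := (Nat.dvd_prime_pow Nat.prime_two (m := 9)).mp a2
    by_contra hlt
    have : (2 : ℕ) ^ 6 ∣ Nat.card (stab f) := by
      rw [a3]
      refine pow_dvd_pow 2 ?_
      by_contra hj'
      have : (2 : ℕ) ^ j ≤ 2 ^ 5 := Nat.pow_le_pow_right (by norm_num) (by omega)
      omega
    obtain ⟨e, he⟩ := this.trans a1
    omega
  have h3 := card_gap (r := 3) (d := 64) hf hV h1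
  obtain ⟨a, ha⟩ := exists_card_diff_eq (r := 2) (d := 64) hf hV hl (by
    rw [hV]
    generalize (supp f).card = w at h1 h2 h3
    obtain ⟨m, rfl⟩ := Nat.exists_eq_add_of_le (show 96 ≤ w by omega)
    have e : 2 * (96 + m) - 3 * 64 = 2 * m := by omega
    rw [e]
    nlinarith) (by omega)
  obtain ⟨π, c, hT, hh⟩ := exists_coordinates (s := 2) hf hV (by norm_num) hdiv ha
  have hs := sum_card_half_ne_zero f (fun x => π x + c) hT card_dot_eq_one_two
  rw [sum_filter_ne_zero_two] at hs
  have b1 := hh ![0, 1] (by decide)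
  have b2 := hh ![1, 0] (by decide)
  have b3 := hh ![1, 1] (by decide)
  have b4 := card_overlap_of_card_diff ha
  omega

theorem cubic_of_card_eq_56 {f : V → ZMod 2} (hf : DegLT 4 f) (hV : Fintype.card V = 256)
    (hw : (supp f).card = 56) (hdiv : ¬ Divisible f) :
    ∃ A B : Finset V, IsFlat A ∧ A.card = 32 ∧ IsFlat B ∧ B.card = 32 ∧ f = ind A + ind B := by
  have hl := card_stab_le hV hw (by norm_num)
  obtain ⟨a, ha⟩ := exists_card_diff_eq (r := 2) (d := 32) hf hV hl (by rw [hV, hw]; norm_num)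
    (by omega)
  obtain ⟨π, c, hT, hh⟩ := exists_coordinates (s := 2) hf hV (by norm_num) hdiv ha
  have hs := sum_card_half_ne_zero f (fun x => π x + c) hT card_dot_eq_one_two
  have b4 := card_overlap_of_card_diff ha
  have hcard : ∀ u ≠ 0, (half f (fun x => π x + c) u).card = 16 := by
    rw [sum_filter_ne_zero_two] at hs
    have b1 := hh ![0, 1] (by decide)
    have b2 := hh ![1, 0] (by decide)
    have b3 := hh ![1, 1] (by decide)
    intro u hu
    have : ∀ u : Fin 2 → ZMod 2, u ≠ 0 → u = ![0, 1] ∨ u = ![1, 0] ∨ u = ![1, 1] := by decide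
    rcases this u hu with rfl | rfl | rfl <;> omega
  obtain ⟨A, hA, hcA, hAf⟩ := exists_flat_of_card_half (r := 3) (m := 8) (k := 1) hf hV π c hT hcard
    (by norm_num) (fun v hv => by rw [card_dot_two v hv]; omega) (by norm_num)
    card_dot_eq_one_pair_two exists_flags_two
  obtain ⟨B, hB, hcB, h⟩ := eq_add_ind_of_inter (r := 3) hf hV hA hcA (by omega) (by omega)
  exact ⟨A, B, hA, hcA, hB, hcB, h⟩

theorem divisible_of_card_eq_60 {f : V → ZMod 2} (hf : DegLT 4 f) (hV : Fintype.card V = 256)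
    (hw : (supp f).card = 60) : Divisible f := by
  by_contra hdiv
  have hl := card_stab_le hV hw (by norm_num)
  obtain ⟨a, ha⟩ := exists_card_diff_eq (r := 2) (d := 32) hf hV hl (by rw [hV, hw]; norm_num)
    (by omega)
  obtain ⟨π, c, hT, hh⟩ := exists_coordinates (s := 2) hf hV (by norm_num) hdiv ha
  have hs := sum_card_half_ne_zero f (fun x => π x + c) hT card_dot_eq_one_two
  have b4 := card_overlap_of_card_diff ha
  set ρ := fun x => π x + c with hρ
  have hgap : ∀ u, 16 < (half f ρ u).card → 24 ≤ (half f ρ u).card := by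
    intro u hu
    have := card_gap (r := 4) (d := 16) (degLT_mul_dot hf π c u) hV (by rwa [supp_mul_dot])
    rw [supp_mul_dot] at this
    change 3 * 16 ≤ 2 * (half f ρ u).card at this
    omega
  have hpair : ∀ u u' : Fin 2 → ZMod 2, u ≠ 0 → u' ≠ 0 → u ≠ u' →
      32 < (half f ρ u).card + (half f ρ u').card := by
    intro u u' hu hu' huu
    have e1 : half f ρ u ∪ half f ρ u' = overlap f a := by
      ext x
      rw [mem_union, mem_half, mem_half, hT, dot_eq_one_or u hu u' hu' huu, and_or_left]
    have e2 := Finset.card_union_add_card_inter (half f ρ u) (half f ρ u')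
    rw [e1] at e2
    have e3 : supp ((f * fun x => u ⬝ᵥ ρ x) * fun x => u' ⬝ᵥ ρ x) = half f ρ u ∩ half f ρ u' := by
      rw [supp_mul, supp_mul_dot]
      ext x
      simp only [mem_inter, mem_half, mem_supp]
      tauto
    have e4 := card_le_of_degLT (r := 5) (degLT_mul_dot (degLT_mul_dot hf π c u) π c u')
    change (f * fun x => u ⬝ᵥ ρ x) * (fun x => u' ⬝ᵥ ρ x) ≠ 0 → Fintype.card V ≤ 2 ^ 5 * (supp
      ((f * fun x => u ⬝ᵥ ρ x) * fun x => u' ⬝ᵥ ρ x)).card at e4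
    rw [Ne, ← supp_eq_empty, e3, hV] at e4
    have b1 := hh u hu
    have b2 := hh u' hu'
    have e5 : half f ρ u ∩ half f ρ u' ≠ ∅ := by
      intro h
      rw [h, card_empty] at e2
      omega
    have := e4 e5
    omega
  rw [sum_filter_ne_zero_two] at hs
  have b1 := hh ![0, 1] (by decide)
  have b2 := hh ![1, 0] (by decide)
  have b3 := hh ![1, 1] (by decide)
  have g1 := hgap ![0, 1]
  have g2 := hgap ![1, 0]
  have g3 := hgap ![1, 1]
  have p1 := hpair ![0, 1] ![1, 0] (by decide) (by decide) (by decide)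
  have p2 := hpair ![0, 1] ![1, 1] (by decide) (by decide) (by decide)
  have p3 := hpair ![1, 0] ![1, 1] (by decide) (by decide) (by decide)
  omega

/-- A derivative contained in an affine hyperplane confines `f` to it, if the overlap is small. -/
theorem divisible_of_divisible_diff {r : ℕ} {f : V → ZMod 2} (hf : DegLT (r + 1) f) {a : V}
    (hdiv : Divisible (diff a f)) (hov : 2 ^ (r + 1) * (overlap f a).card < Fintype.card V) :
    Divisible f := by
  obtain ⟨φ, hφ, c, hc⟩ := hdiv
  refine ⟨φ, hφ, c, fun q hq => ?_⟩
  by_contra hne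
  have hne' : φ q = c + 1 := by
    have : ∀ y z : ZMod 2, y ≠ z → y = z + 1 := by decide
    exact this _ _ hne
  have h1 := card_ge_of_inter_half hf φ c hq hne'
  have h2 : (supp f).filter (fun x => φ x = c + 1) ⊆ overlap f a := by
    intro x hx
    rw [mem_filter, mem_supp] at hx
    rw [mem_overlap]
    refine ⟨hx.1, ?_⟩
    by_contra h
    have h3 : diff a f x = 1 := by
      simp only [diff, hx.1]
      rcases zmod_two_cases (f (x + a)) with h' | h'
      · rw [h', zero_add]
      · exact absurd h' h
    have := hc x h3
    rw [hx.2] at this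
    simp at this
  have := Nat.mul_le_mul_left (2 ^ (r + 1)) (Finset.card_le_card h2)
  omega

theorem exists_card_diff_eq_64 {f : V → ZMod 2} (hf : DegLT 5 f) (hV : Fintype.card V = 512)
    (hw : (supp f).card = 56 ∨ (supp f).card = 60) (hdiv : ¬ Divisible f) :
    ∃ a, (supp (diff a f)).card = 2 * 32 := by
  by_contra! hne
  have hlarge : ∀ a, a ∉ stab f → 112 ≤ (supp (diff a f)).card := by
    intro a ha
    by_contra hlt
    have h1 := card_diff_ge (r := 3) (d := 32) hf hV ha (hne a)
    have h2 := divisible_of_card_lt (hf a) hV (by omega) (by omega)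
    have h3 := card_supp_diff f a
    exact hdiv (divisible_of_divisible_diff (r := 4) hf h2 (by rw [hV]; omega))
  have h1 := sq_card_le_of_overlap_le (f := f) (M := 2 * (supp f).card - 112) (fun a ha => by
    have := hlarge a ha
    have := card_supp_diff f a
    omega)
  rw [hV] at h1
  rcases hw with hw | hw
  · have hl := card_stab_le hV hw (by norm_num)
    norm_num at hl
    rw [hw] at h1
    omega
  · have hl := card_stab_le hV hw (by norm_num)
    norm_num at hl
    rw [hw] at h1
    omega

theorem divisible_of_card_eq_56 {f : V → ZMod 2} (hf : DegLT 5 f) (hV : Fintype.card V = 512)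
    (hw : (supp f).card = 56) : Divisible f := by
  by_contra hdiv
  obtain ⟨a, ha⟩ := exists_card_diff_eq_64 hf hV (Or.inl hw) hdiv
  obtain ⟨π, c, hT, hh⟩ := exists_coordinates (s := 3) hf hV (by norm_num) hdiv ha
  have hs := sum_card_half_ne_zero f (fun x => π x + c) hT card_dot_eq_one_three
  have b4 := card_overlap_of_card_diff ha
  have h1 := Finset.card_nsmul_le_sum (univ.filter (fun u : Fin 3 → ZMod 2 => u ≠ 0))
    (fun u => (half f (fun x => π x + c) u).card) 16 (fun u hu => by
      have := hh u (by simpa using hu)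
      omega)
  have h2 : (univ.filter (fun u : Fin 3 → ZMod 2 => u ≠ 0)).card = 7 := by decide
  rw [h2, hs, smul_eq_mul] at h1
  omega

theorem quartic_of_card_eq_60 {f : V → ZMod 2} (hf : DegLT 5 f) (hV : Fintype.card V = 512)
    (hw : (supp f).card = 60) (hdiv : ¬ Divisible f) :
    ∃ A B : Finset V, IsFlat A ∧ A.card = 32 ∧ IsFlat B ∧ B.card = 32 ∧ f = ind A + ind B := by
  obtain ⟨a, ha⟩ := exists_card_diff_eq_64 hf hV (Or.inr hw) hdiv
  obtain ⟨π, c, hT, hh⟩ := exists_coordinates (s := 3) hf hV (by norm_num) hdiv ha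
  have hs := sum_card_half_ne_zero f (fun x => π x + c) hT card_dot_eq_one_three
  have b4 := card_overlap_of_card_diff ha
  have hcard : ∀ u ≠ 0, (half f (fun x => π x + c) u).card = 16 := by
    intro u hu
    have hge : ∀ u ∈ univ.filter (fun u : Fin 3 → ZMod 2 => u ≠ 0),
        16 ≤ (half f (fun x => π x + c) u).card := fun u hu => by
      have := hh u (by simpa using hu)
      omega
    have h2 : (univ.filter (fun u : Fin 3 → ZMod 2 => u ≠ 0)).card = 7 := by decide
    have := (Finset.sum_eq_sum_iff_of_le hge).mp (by
      rw [hs, Finset.sum_const, h2, smul_eq_mul]; omega) u (by simpa using hu)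
    exact this.symm
  obtain ⟨A, hA, hcA, hAf⟩ := exists_flat_of_card_half (r := 4) (m := 4) (k := 2) hf hV π c hT hcard
    (by norm_num) (fun v hv => by rw [card_dot_three v hv]; omega) (by norm_num)
    card_dot_eq_one_pair_three exists_flags_three
  obtain ⟨B, hB, hcB, h⟩ := eq_add_ind_of_inter (r := 4) hf hV hA hcA (by omega) (by omega)
  exact ⟨A, B, hA, hcA, hB, hcB, h⟩

end Classification

section Quadratic

variable {V : Type*} [AddCommGroup V] [Module (ZMod 2) V] [Fintype V] [DecidableEq V]

theorem card_supp_add_one (f : V → ZMod 2) :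
    (supp (f + 1)).card + (supp f).card = Fintype.card V := by
  have h : supp (f + 1) = univ.filter (fun x => ¬ x ∈ supp f) := by
    ext x
    rw [mem_filter, notMem_supp, mem_supp, Pi.add_apply, Pi.one_apply, add_eq_right]
    simp
  rw [h, ← Finset.card_univ, ← Finset.card_filter_add_card_filter_not (s := univ) (· ∈ supp f),
    add_comm]
  congr 2
  ext x; simp

theorem card_supp_of_degLT_two {g : V → ZMod 2} (hg : DegLT 2 g) {n : ℕ}
    (hV : Fintype.card V = 2 * n) (h0 : g ≠ 0) (h1 : g ≠ 1) : (supp g).card = n := by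
  have h2 : g + 1 ≠ 0 := fun h => h1 (funext fun x => CharTwo.add_eq_zero.mp (congrFun h x))
  have a1 := card_le_of_degLT (r := 1) hg h0
  have a2 := card_le_of_degLT (r := 1) (hg.add (degLT_const 1).succ : DegLT 2 (g + 1)) h2
  have a3 := card_supp_add_one g
  omega

theorem sum_card_supp_diff (f : V → ZMod 2) :
    ∑ a, (supp (diff a f)).card + 2 * (supp f).card ^ 2 = 2 * (supp f).card * Fintype.card V := by
  rw [← sum_card_overlap, Finset.mul_sum, ← Finset.sum_add_distrib,
    Finset.sum_congr rfl (fun a _ => card_supp_diff f a), Finset.sum_const, Finset.card_univ,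
    smul_eq_mul, mul_comm]

theorem card_filter_diff_eq_one {f : V → ZMod 2} {a : V} (ha : diff a f = 1) :
    (univ.filter (fun b => diff b f = 1)).card = Nat.card (stab f) := by
  classical
  rw [Nat.card_eq_fintype_card, Fintype.card_subtype]
  have key : ∀ b, diff b f = 1 ↔ b + a ∈ stab f := by
    intro b
    rw [mem_stab, funext_iff]
    have : ∀ x, f (x + (b + a)) = f (x + b) + 1 := by
      intro x
      have := congrFun ha (x + b)
      simp only [diff, Pi.one_apply] at this
      rw [← add_assoc, ← this]
      linear_combination -(CharTwo.add_self_eq_zero (f (x + b)))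
    refine forall_congr' fun x => ?_
    rw [this x]
    simp only [diff, Pi.one_apply]
    generalize f (x + b) = y
    generalize f x = z
    revert y z
    decide
  refine Finset.card_bij (fun b _ => b + a) ?_ ?_ ?_
  · intro b hb; simpa [key] using hb
  · intro x _ y _ h; exact add_right_cancel h
  · intro b hb
    refine ⟨b + a, ?_, add_add_cancel _ _⟩
    simpa [key, add_add_cancel] using hb

/-- The possible weights of a quadratic form. -/
theorem sq_card_supp_quadratic {f : V → ZMod 2} (hf : DegLT 3 f) {n : ℕ}
    (hV : Fintype.card V = 2 * n) :
    (supp f).card = n ∨ 2 * ((supp f).card - n : ℤ) ^ 2 = n * Nat.card (stab f) := by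
  classical
  have hL : (univ.filter (fun a => a ∈ stab f)).card = Nat.card (stab f) := by
    rw [Nat.card_eq_fintype_card, Fintype.card_subtype]
  have h01 : (0 : V → ZMod 2) ≠ 1 := fun h => by simpa using congrFun h 0
  have h1 : ∀ a, (supp (diff a f)).card + (if a ∈ stab f then n else 0) =
      n + (if diff a f = 1 then n else 0) := by
    intro a
    by_cases ha : a ∈ stab f
    · rw [if_pos ha, diff_eq_zero.mpr ha, supp_eq_empty.mpr rfl, card_empty, if_neg h01]
      omega
    · rw [if_neg ha]
      by_cases hb : diff a f = 1
      · rw [if_pos hb, hb]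
        have : supp (1 : V → ZMod 2) = univ := by ext x; simp
        rw [this, Finset.card_univ, hV]
        omega
      · rw [if_neg hb, card_supp_of_degLT_two (hf a) hV (fun h => ha (diff_eq_zero.mp h)) hb]
  have h2 := Finset.sum_congr rfl (fun a (_ : a ∈ (univ : Finset V)) => h1 a)
  rw [Finset.sum_add_distrib, Finset.sum_add_distrib, ← Finset.sum_filter, ← Finset.sum_filter,
    Finset.sum_const, Finset.sum_const, Finset.sum_const, Finset.card_univ, smul_eq_mul,
    smul_eq_mul, smul_eq_mul, hV] at h2
  have h3 := sum_card_supp_diff f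
  rw [hV] at h3
  by_cases hR : ∃ a, diff a f = 1
  · left
    obtain ⟨a, ha⟩ := hR
    rw [card_filter_diff_eq_one ha, hL] at h2
    have h4 : (((supp f).card : ℤ) - n) ^ 2 = 0 := by
      zify at h2 h3
      linarith
    have := pow_eq_zero_iff (two_ne_zero) |>.mp h4
    omega
  · right
    push Not at hR
    rw [Finset.filter_false_of_mem (fun a _ => hR a), card_empty, hL] at h2
    zify at h2 h3
    linear_combination h3 - h2

theorem card_supp_quadratic {f : V → ZMod 2} (hf : DegLT 3 f) (hV : Fintype.card V = 128) :
    (supp f).card ∈ ({0, 32, 48, 56, 64, 72, 80, 96, 128} : Finset ℕ) := by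
  have hle : (supp f).card ≤ 128 := hV ▸ Finset.card_le_univ _
  rcases sq_card_supp_quadratic (n := 64) hf hV with h | h
  · rw [h]; decide
  · have a2 := card_stab_dvd_card f
    rw [hV] at a2
    obtain ⟨j, hj, a3⟩ := (Nat.dvd_prime_pow Nat.prime_two (m := 7)).mp a2
    rw [a3] at h
    generalize (supp f).card = w at h hle
    clear a2 a3
    interval_cases j <;> norm_num at h <;> interval_cases w <;> first | decide | norm_num at h

end Quadratic

section Restrict

variable {V : Type*} [AddCommGroup V] [Module (ZMod 2) V] [Fintype V] [DecidableEq V]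

theorem Divisible.exists_restrict {k n : ℕ} {f : V → ZMod 2} (hdiv : Divisible f)
    (hf : DegLT (k + 1) f) (hV : Fintype.card V = 2 * n) :
    ∃ (K : Submodule (ZMod 2) V) (p : V), Nat.card K = n ∧
      DegLT k (fun y : K => f (y + p)) ∧ ∀ x, f x = 1 → x + p ∈ K := by
  obtain ⟨φ, hφ, c, hc⟩ := hdiv
  obtain ⟨b, hb⟩ : ∃ b, φ b = 1 := by
    by_contra! h
    exact hφ (LinearMap.ext fun x => (zmod_two_cases _).resolve_right (h x))
  have hp : φ (c • b) = c := by rw [map_smul, hb, smul_eq_mul, mul_one]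
  refine ⟨LinearMap.ker φ, c • b, ?_, ?_, fun x hx => ?_⟩
  · have hsurj : Function.Surjective φ := fun z => ⟨z • b, by simp [hb]⟩
    have h1 := Submodule.card_eq_card_quotient_mul_card (LinearMap.ker φ)
    rw [Nat.card_congr (φ.quotKerEquivOfSurjective hsurj).toEquiv, Nat.card_zmod,
      Nat.card_eq_fintype_card (α := V), hV] at h1
    omega
  · have h1 := (hf b).comp (LinearMap.ker φ).subtype (c • b)
    convert h1 using 2 with y
    simp only [diff, Submodule.subtype_apply]
    rw [notMem_supp (x := (y : V) + c • b + b) (f := f) |>.mp, zero_add]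
    rw [mem_supp]
    intro h
    have h2 := hc _ h
    rw [map_add, map_add, hp, hb, LinearMap.mem_ker.mp y.2, zero_add, add_eq_left] at h2
    exact one_ne_zero h2
  · rw [LinearMap.mem_ker, map_add, hp, hc x hx, CharTwo.add_self_eq_zero]

variable {K : Submodule (ZMod 2) V} [Fintype K] {f : V → ZMod 2} {p : V}

theorem supp_eq_image (h : ∀ x, f x = 1 → x + p ∈ K) :
    supp f = (supp (fun y : K => f (y + p))).image (fun y : K => (y : V) + p) := by
  ext x
  simp only [mem_supp, Finset.mem_image]
  constructor
  · intro hx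
    exact ⟨⟨x + p, h x hx⟩, by simpa [add_add_cancel] using hx, add_add_cancel _ _⟩
  · rintro ⟨y, hy, rfl⟩; exact hy

theorem coe_add_injective : Function.Injective (fun y : K => (y : V) + p) := by
  intro x y h
  exact Subtype.ext (add_right_cancel h)

theorem card_supp_restrict (h : ∀ x, f x = 1 → x + p ∈ K) :
    (supp (fun y : K => f (y + p))).card = (supp f).card := by
  rw [supp_eq_image h, card_image_of_injective _ coe_add_injective]

theorem exists_flats_of_restrict (h : ∀ x, f x = 1 → x + p ∈ K) {A B : Finset K} (hA : IsFlat A)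
    (hB : IsFlat B) (hf : (fun y : K => f (y + p)) = ind A + ind B) :
    ∃ A' B' : Finset V, IsFlat A' ∧ A'.card = A.card ∧ IsFlat B' ∧ B'.card = B.card ∧
      f = ind A' + ind B' := by
  refine ⟨A.image (fun y : K => (y : V) + p), B.image (fun y : K => (y : V) + p),
    hA.map K.subtype p,
    card_image_of_injective _ coe_add_injective, hB.map K.subtype p,
    card_image_of_injective _ coe_add_injective, supp_injective ?_⟩
  rw [supp_eq_image h, hf, supp_add, supp_add, supp_ind, supp_ind, supp_ind, supp_ind,
    Finset.image_symmDiff _ _ coe_add_injective]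

end Restrict

section Nine

variable {V : Type*} [AddCommGroup V] [Module (ZMod 2) V] [Fintype V] [DecidableEq V]

theorem exists_flats_of_card_eq_60 {f : V → ZMod 2} (hf : DegLT 5 f) (hV : Fintype.card V = 512)
    (hw : (supp f).card = 60) :
    ∃ A B : Finset V, IsFlat A ∧ A.card = 32 ∧ IsFlat B ∧ B.card = 32 ∧ f = ind A + ind B := by
  classical
  by_cases hdiv : Divisible f
  · obtain ⟨K, p, hK, hg, hs⟩ := hdiv.exists_restrict (n := 256) hf hV
    let _ : Fintype K := Fintype.ofFinite K
    rw [Nat.card_eq_fintype_card] at hK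
    have hw' := card_supp_restrict hs
    rw [hw] at hw'
    obtain ⟨K', p', hK', hg', hs'⟩ :=
      (divisible_of_card_eq_60 hg hK hw').exists_restrict (n := 128) hg hK
    let _ : Fintype K' := Fintype.ofFinite K'
    rw [Nat.card_eq_fintype_card] at hK'
    have h1 := card_supp_quadratic hg' hK'
    rw [card_supp_restrict hs', hw'] at h1
    exact absurd h1 (by decide)
  · exact quartic_of_card_eq_60 hf hV hw hdiv

theorem exists_flats_of_card_eq_56 {f : V → ZMod 2} (hf : DegLT 5 f) (hV : Fintype.card V = 512)
    (hw : (supp f).card = 56) :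
    (∃ A B : Finset V, IsFlat A ∧ A.card = 32 ∧ IsFlat B ∧ B.card = 32 ∧ f = ind A + ind B) ∨
      ∃ F : Finset V, IsFlat F ∧ F.card = 128 ∧ supp f ⊆ F := by
  classical
  obtain ⟨K, p, hK, hg, hs⟩ := (divisible_of_card_eq_56 hf hV hw).exists_restrict (n := 256) hf hV
  let _ : Fintype K := Fintype.ofFinite K
  rw [Nat.card_eq_fintype_card] at hK
  have hw' := card_supp_restrict hs
  rw [hw] at hw'
  by_cases hdiv : Divisible (fun y : K => f (y + p))
  · right
    obtain ⟨K', p', hK', hg', hs'⟩ := hdiv.exists_restrict (n := 128) hg hK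
    let _ : Fintype K' := Fintype.ofFinite K'
    rw [Nat.card_eq_fintype_card] at hK'
    have huniv : IsFlat (univ : Finset K') := ⟨⟨0, mem_univ _⟩, fun _ _ _ _ _ _ => mem_univ _⟩
    refine ⟨(univ.image (fun y : K' => (y : K) + p')).image (fun y : K => (y : V) + p),
      (huniv.map K'.subtype p').map K.subtype p, ?_, ?_⟩
    · rw [card_image_of_injective _ coe_add_injective, card_image_of_injective _ coe_add_injective,
        Finset.card_univ, hK']
    · rw [supp_eq_image hs, supp_eq_image hs']
      exact image_subset_image (image_subset_image (subset_univ _))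
  · left
    obtain ⟨A, B, hA, hcA, hB, hcB, h⟩ := cubic_of_card_eq_56 hg hK hw' hdiv
    obtain ⟨A', B', hA', hcA', hB', hcB', h'⟩ := exists_flats_of_restrict hs hA hB h
    exact ⟨A', B', hA', hcA'.trans hcA, hB', hcB'.trans hcB, h'⟩

end Nine

section NormalForm

variable {m : ℕ}

theorem anf_eq_sum (f : BF m) (S : Finset (Fin m)) :
    anf f S = ∑ x, if supp x ⊆ S then f x else 0 := by
  rw [anf, Finset.sum_filter]
  refine Finset.sum_congr rfl fun x _ => if_congr ?_ rfl rfl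
  simp [Finset.subset_iff]

theorem supp_add_single_subset {S : Finset (Fin m)} {i : Fin m} (hi : i ∉ S)
    (x : Fin m → ZMod 2) :
    supp (x + Pi.single i 1) ⊆ S ↔ supp x ⊆ insert i S ∧ x i = 1 := by
  simp only [Finset.subset_iff, mem_supp, mem_insert, Pi.add_apply]
  constructor
  · intro h
    refine ⟨fun j hj => ?_, ?_⟩
    · by_cases hji : j = i
      · exact Or.inl hji
      · exact Or.inr (h (by rw [Pi.single_eq_of_ne hji, hj, add_zero]))
    · rcases zmod_two_cases (x i) with h' | h'
      · exact absurd (h (by rw [Pi.single_eq_same, h', zero_add])) hi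
      · exact h'
  · rintro ⟨h, h1⟩ j hj
    by_cases hji : j = i
    · rw [hji, Pi.single_eq_same, h1, CharTwo.add_self_eq_zero] at hj
      exact absurd hj.symm one_ne_zero
    · rw [Pi.single_eq_of_ne hji, add_zero] at hj
      exact (h hj).resolve_left hji

theorem supp_subset_iff {S : Finset (Fin m)} {i : Fin m} (hi : i ∉ S) (x : Fin m → ZMod 2) :
    supp x ⊆ S ↔ supp x ⊆ insert i S ∧ x i = 0 := by
  simp only [Finset.subset_iff, mem_supp, mem_insert]
  constructor
  · intro h
    exact ⟨fun j hj => Or.inr (h hj),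
      (zmod_two_cases _).resolve_right fun h' => hi (h h')⟩
  · rintro ⟨h, h1⟩ j hj
    refine (h hj).resolve_left ?_
    rintro rfl
    rw [h1] at hj
    exact zero_ne_one hj

theorem anf_insert (f : BF m) {S : Finset (Fin m)} {i : Fin m} (hi : i ∉ S) :
    anf f (insert i S) = anf (diff (Pi.single i 1) f) S := by
  simp only [anf_eq_sum, diff]
  have h1 : ∑ x : Fin m → ZMod 2, (if supp x ⊆ S then f (x + Pi.single i 1) else 0) =
      ∑ x : Fin m → ZMod 2, (if supp (x + Pi.single i 1) ⊆ S then f x else 0) := by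
    refine Fintype.sum_equiv (Equiv.addRight (Pi.single i 1)) _ _ fun x => ?_
    simp only [Equiv.coe_addRight, add_add_cancel]
  have h2 : ∀ x : Fin m → ZMod 2, (if supp x ⊆ S then f (x + Pi.single i 1) + f x else 0) =
      (if supp x ⊆ S then f (x + Pi.single i 1) else 0) + if supp x ⊆ S then f x else 0 := by
    intro x
    split_ifs <;> simp
  rw [Finset.sum_congr rfl (fun x _ => h2 x), Finset.sum_add_distrib, h1, ← Finset.sum_add_distrib]
  refine Finset.sum_congr rfl fun x _ => ?_
  rw [if_congr (supp_add_single_subset hi x) rfl rfl, if_congr (supp_subset_iff hi x) rfl rfl]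
  rcases zmod_two_cases (x i) with h | h <;> simp [h]

theorem DegLT.anf_eq_zero {k : ℕ} {f : BF m} (hf : DegLT k f) {S : Finset (Fin m)}
    (hS : k ≤ S.card) : anf f S = 0 := by
  induction k generalizing f S with
  | zero => exact Finset.sum_eq_zero fun x _ => hf x
  | succ k ih =>
    obtain ⟨i, hi⟩ : S.Nonempty := Finset.card_pos.mp (by omega)
    rw [← Finset.insert_erase hi, anf_insert f (notMem_erase i S)]
    exact ih (hf _) (by rw [card_erase_of_mem hi]; omega)

/-- The monomial `∏_{i ∈ S} x i`. -/
def monomial (S : Finset (Fin m)) : BF m := fun x => ∏ i ∈ S, x i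

theorem degLT_monomial (S : Finset (Fin m)) : DegLT (S.card + 1) (monomial S) := by
  classical
  induction S using Finset.induction_on with
  | empty => exact degLT_const 1
  | insert i S hi ih =>
    have h := (degLT_linear (LinearMap.proj i : (Fin m → ZMod 2) →ₗ[ZMod 2] ZMod 2) 0).mul ih
    rw [card_insert_of_notMem hi]
    rw [show 2 + (S.card + 1) - 1 = S.card + 1 + 1 by omega] at h
    convert h using 1
    funext x
    simp [monomial, Finset.prod_insert hi]

theorem monomial_apply (S : Finset (Fin m)) (x : Fin m → ZMod 2) :
    monomial S x = if S ⊆ supp x then 1 else 0 := by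
  rw [monomial]
  split_ifs with h
  · exact Finset.prod_eq_one fun i hi => mem_supp.mp (h hi)
  · obtain ⟨i, hi, hx⟩ := Finset.not_subset.mp h
    exact Finset.prod_eq_zero hi (notMem_supp.mp hx)

theorem sum_anf_monomial (f : BF m) : ∑ S, anf f S • monomial S = f := by
  funext y
  simp only [Finset.sum_apply, Pi.smul_apply, smul_eq_mul, monomial_apply, anf_eq_sum,
    Finset.sum_mul]
  rw [Finset.sum_comm]
  rw [Finset.sum_eq_single y]
  · have : ∀ S : Finset (Fin m), ((if supp y ⊆ S then f y else 0) * if S ⊆ supp y then 1 else 0) =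
        if S = supp y then f y else 0 := by
      intro S
      simp only [Finset.Subset.antisymm_iff]
      split_ifs <;> simp_all
    simp [this]
  · intro x _ hx
    have h1 : ∀ S : Finset (Fin m), ((if supp x ⊆ S then f x else 0) * if S ⊆ supp y then 1 else 0) =
        if S ∈ Icc (supp x) (supp y) then f x else 0 := by
      intro S
      simp only [Finset.mem_Icc]
      split_ifs <;> simp_all
    rw [Finset.sum_congr rfl (fun S _ => h1 S), Finset.sum_ite_mem, univ_inter, Finset.sum_const]
    by_cases hs : supp x ⊆ supp y
    · have hlt : (supp x).card < (supp y).card :=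
        Finset.card_lt_card (hs.ssubset_of_ne fun h => hx (supp_injective h))
      rw [card_Icc_finset hs, show (supp y).card - (supp x).card =
        (supp y).card - (supp x).card - 1 + 1 by omega, pow_succ, mul_smul, two_smul,
        CharTwo.add_self_eq_zero, smul_zero]
    · rw [Finset.Icc_eq_empty hs, card_empty, zero_smul]
  · intro h; exact absurd (mem_univ y) h

theorem DegLT.sum {V ι : Type*} [AddCommGroup V] [Module (ZMod 2) V] {k : ℕ} {s : Finset ι}
    {f : ι → V → ZMod 2} (h : ∀ i ∈ s, DegLT k (f i)) : DegLT k (∑ i ∈ s, f i) := by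
  classical
  induction s using Finset.induction_on with
  | empty => exact degLT_zero k
  | insert i s hi ih =>
    rw [Finset.sum_insert hi]
    exact (h i (mem_insert_self i s)).add (ih fun j hj => h j (mem_insert_of_mem hj))

theorem mem_RM_iff {r : ℕ} {f : BF m} : f ∈ RM r m ↔ DegLT (r + 1) f := by
  rw [RM, Finset.mem_filter]
  refine ⟨fun h => ?_, fun h => ⟨mem_univ _, fun S hS => h.anf_eq_zero hS⟩⟩
  rw [← sum_anf_monomial f]
  refine DegLT.sum fun S _ => ?_
  rcases zmod_two_cases (anf f S) with h0 | h1
  · rw [h0, zero_smul]; exact degLT_zero _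
  · rw [h1, one_smul]
    refine (degLT_monomial S).mono ?_
    by_contra hS
    rw [h.2 S (by omega)] at h1
    exact zero_ne_one h1

theorem anf_bijective : Function.Bijective (anf : BF m → Finset (Fin m) → ZMod 2) := by
  rw [Fintype.bijective_iff_injective_and_card]
  refine ⟨fun f g h => ?_, by simp⟩
  rw [← sum_anf_monomial f, ← sum_anf_monomial g, h]

theorem card_RM (r m : ℕ) :
    (RM r m).card = 2 ^ (univ.filter (fun S : Finset (Fin m) => S.card ≤ r)).card := by
  have h : (RM r m).card = (Fintype.piFinset fun S : Finset (Fin m) =>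
      if r < S.card then ({0} : Finset (ZMod 2)) else univ).card := by
    refine Finset.card_bij (fun f _ => anf f) ?_ (fun f _ g _ h => anf_bijective.1 h) ?_
    · intro f hf
      rw [Fintype.mem_piFinset]
      intro S
      split_ifs with hS
      · simpa using (Finset.mem_filter.mp hf).2 S hS
      · exact mem_univ _
    · intro c hc
      obtain ⟨f, rfl⟩ := anf_bijective.2 c
      refine ⟨f, Finset.mem_filter.mpr ⟨mem_univ _, fun S hS => ?_⟩, rfl⟩
      have := Fintype.mem_piFinset.mp hc S
      rwa [if_pos hS, mem_singleton] at this
  rw [h, Fintype.card_piFinset]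
  have h2 : ∀ S : Finset (Fin m), (if r < S.card then ({0} : Finset (ZMod 2)) else univ).card =
      if S.card ≤ r then 2 else 1 := by
    intro S
    by_cases hS : r < S.card
    · rw [if_pos hS, if_neg (by omega), card_singleton]
    · rw [if_neg hS, if_pos (by omega), Finset.card_univ, ZMod.card]
  rw [Finset.prod_congr rfl (fun S _ => h2 S), ← Finset.prod_filter, Finset.prod_const]

theorem card_RM_two_seven : (RM 2 7).card = 2 ^ 29 := by
  rw [card_RM]
  congr 1

end NormalForm

section Moments

variable {V : Type*} [AddCommGroup V] [Module (ZMod 2) V] [Fintype V] [DecidableEq V]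

theorem exists_linear_ne {x y : V} (h : x ≠ y) : ∃ φ : V →ₗ[ZMod 2] ZMod 2, φ x ≠ φ y := by
  have hx : IsFlat ({x} : Finset V) := by
    refine ⟨singleton_nonempty x, ?_⟩
    simp only [mem_singleton]
    rintro _ rfl _ rfl _ rfl
    exact add_add_cancel _ _
  obtain ⟨φ, hφ⟩ := exists_linear_separating hx (mem_singleton_self x)
    (q := y) (by simpa using h.symm)
  refine ⟨φ, fun he => ?_⟩
  have := hφ x (mem_singleton_self x)
  rw [he, left_eq_add] at this
  exact one_ne_zero this

/-- Small sets are not orthogonal to all functions of degree at most `k`. -/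
theorem exists_degLT_sum_eq_one {k : ℕ} {P : Finset V} (hP : P.Nonempty)
    (hc : P.card < 2 ^ (k + 1)) : ∃ g : V → ZMod 2, DegLT (k + 1) g ∧ ∑ x ∈ P, g x = 1 := by
  induction k generalizing P with
  | zero =>
    have : P.card = 1 := by
      have := Finset.card_pos.mpr hP
      omega
    exact ⟨fun _ => 1, degLT_const 1, by simp [this]⟩
  | succ k ih =>
    by_cases h1 : P.card = 1
    · exact ⟨fun _ => 1, (degLT_const 1).mono (by omega), by simp [h1]⟩
    · obtain ⟨x, hx, y, hy, hxy⟩ := Finset.one_lt_card.mp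
        (by have := Finset.card_pos.mpr hP; omega : 1 < P.card)
      obtain ⟨φ, hφ⟩ := exists_linear_ne hxy
      have key : ∀ c, (P.filter (fun z => φ z + c = 1)).Nonempty →
          (P.filter (fun z => φ z + c = 1)).card < 2 ^ (k + 1) →
          ∃ g : V → ZMod 2, DegLT (k + 2) g ∧ ∑ x ∈ P, g x = 1 := by
        intro c hne hlt
        obtain ⟨g, hg, hs⟩ := ih hne hlt
        have h2 := hg.mul (degLT_linear φ c)
        refine ⟨_, h2, ?_⟩
        rw [← hs, Finset.sum_filter]
        refine Finset.sum_congr rfl fun z _ => ?_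
        rw [Pi.mul_apply]
        rcases zmod_two_cases (φ z + c) with h | h <;> simp [h]
      have hsum := Finset.card_filter_add_card_filter_not (s := P) (fun z => φ z + 0 = 1)
      have hnot : P.filter (fun z => ¬ φ z + 0 = 1) = P.filter (fun z => φ z + 1 = 1) := by
        refine Finset.filter_congr fun z _ => ?_
        have : ∀ a : ZMod 2, ¬ a + 0 = 1 ↔ a + 1 = 1 := by decide
        exact this _
      rw [hnot] at hsum
      have hsep : ∀ c, (P.filter (fun z => φ z + c = 1)).Nonempty := by
        intro c
        have : ∀ a b c : ZMod 2, a ≠ b → a + c = 1 ∨ b + c = 1 := by decide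
        rcases this _ _ c hφ with h | h
        · exact ⟨x, mem_filter.mpr ⟨hx, h⟩⟩
        · exact ⟨y, mem_filter.mpr ⟨hy, h⟩⟩
      rcases lt_or_ge (P.filter (fun z => φ z + 0 = 1)).card (2 ^ (k + 1)) with h | h
      · exact key 0 (hsep 0) h
      · exact key 1 (hsep 1) (by rw [pow_succ] at hc; omega)

/-- The sign `(-1) ^ c`. -/
def sign (c : ZMod 2) : ℤ := if c = 0 then 1 else -1

theorem sign_add (a b : ZMod 2) : sign (a + b) = sign a * sign b := by
  revert a b; decide

theorem sign_mul_self (a : ZMod 2) : sign a * sign a = 1 := by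
  revert a; decide

theorem sign_sum {ι : Type*} (s : Finset ι) (f : ι → ZMod 2) :
    ∏ i ∈ s, sign (f i) = sign (∑ i ∈ s, f i) := by
  classical
  induction s using Finset.induction_on with
  | empty => rfl
  | insert i s hi ih => rw [Finset.prod_insert hi, Finset.sum_insert hi, sign_add, ih]

theorem sum_sign (f : V → ZMod 2) :
    ∑ x, sign (f x) = Fintype.card V - 2 * (supp f).card := by
  have : ∀ x, sign (f x) = 1 - 2 * (if f x = 1 then 1 else 0) := by
    intro x
    rcases zmod_two_cases (f x) with h | h <;> simp [h, sign]
  rw [Finset.sum_congr rfl (fun x _ => this x), Finset.sum_sub_distrib, ← Finset.mul_sum,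
    Finset.sum_const, Finset.card_univ, Finset.sum_boole]
  simp [supp]

/-- The signed moments of a code. -/
def moment (C : Finset (V → ZMod 2)) (j : ℕ) (P : Finset V) : ℤ :=
  ∑ g ∈ C, (∑ x, sign (g x)) ^ j * ∏ x ∈ P, sign (g x)

theorem moment_succ (C : Finset (V → ZMod 2)) (j : ℕ) (P : Finset V) :
    moment C (j + 1) P = ∑ x, moment C j (symmDiff P {x}) := by
  simp only [moment]
  rw [Finset.sum_comm]
  refine Finset.sum_congr rfl fun g _ => ?_
  rw [pow_succ, ← Finset.mul_sum, mul_assoc, Finset.sum_mul]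
  congr 1
  refine Finset.sum_congr rfl fun x _ => ?_
  by_cases hx : x ∈ P
  · have : symmDiff P {x} = P.erase x := by
      ext y
      simp only [mem_symmDiff, mem_singleton, mem_erase]
      grind
    rw [this, ← Finset.mul_prod_erase P _ hx, ← mul_assoc, sign_mul_self, one_mul]
  · have : symmDiff P {x} = insert x P := by
      ext y
      simp only [mem_symmDiff, mem_singleton, mem_insert]
      grind
    rw [this, Finset.prod_insert hx]

/-- The moments of a code whose dual has large minimal distance, divided by its size; `n` is the
length and `s` the size of the set. -/
def momentValue (n : ℕ) : ℕ → ℕ → ℤ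
  | 0, s => if s = 0 then 1 else 0
  | j + 1, s => s * momentValue n j (s - 1) + (n - s) * momentValue n j (s + 1)

theorem moment_eq {C : Finset (V → ZMod 2)} {k : ℕ} (hC : ∀ g, g ∈ C ↔ DegLT (k + 1) g) {j : ℕ}
    {P : Finset V} (hP : j + P.card < 2 ^ (k + 1)) :
    moment C j P = C.card * momentValue (Fintype.card V) j P.card := by
  induction j generalizing P with
  | zero =>
    rw [momentValue]
    rcases P.eq_empty_or_nonempty with rfl | hne
    · simp [moment]
    · have hcard : P.card ≠ 0 := (Finset.card_pos.mpr hne).ne'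
      rw [if_neg hcard, mul_zero]
      obtain ⟨g₀, hg₀, hs⟩ := exists_degLT_sum_eq_one hne (by omega : P.card < 2 ^ (k + 1))
      have h : moment C 0 P = - moment C 0 P := by
        simp only [moment, pow_zero, one_mul, sign_sum]
        rw [← Finset.sum_neg_distrib]
        refine Finset.sum_bij (fun g _ => g + g₀) ?_ ?_ ?_ ?_
        · intro g hg
          rw [hC] at *
          exact hg.add hg₀
        · intro g _ g' _ h; exact add_right_cancel h
        · intro g hg
          refine ⟨g + g₀, ?_, ?_⟩
          · rw [hC] at *
            exact hg.add hg₀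
          · exact add_add_cancel g g₀
        · intro g _
          simp only [Pi.add_apply, Finset.sum_add_distrib, hs, sign_add]
          simp [sign]
      omega
  | succ j ih =>
    have h1 : ∀ x, moment C j (symmDiff P {x}) = C.card * (if x ∈ P then
        momentValue (Fintype.card V) j (P.card - 1)
        else momentValue (Fintype.card V) j (P.card + 1)) := by
      intro x
      by_cases hx : x ∈ P
      · have : symmDiff P {x} = P.erase x := by
          ext y
          simp only [mem_symmDiff, mem_singleton, mem_erase]
          grind
        rw [if_pos hx, this, ih (by rw [card_erase_of_mem hx]; omega), card_erase_of_mem hx]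
      · have : symmDiff P {x} = insert x P := by
          ext y
          simp only [mem_symmDiff, mem_singleton, mem_insert]
          grind
        rw [if_neg hx, this, ih (by rw [card_insert_of_notMem hx]; omega),
          card_insert_of_notMem hx]
    rw [moment_succ, Finset.sum_congr rfl (fun x _ => h1 x), ← Finset.mul_sum, Finset.sum_ite,
      Finset.sum_const, Finset.sum_const, momentValue, nsmul_eq_mul, nsmul_eq_mul]
    have h2 : univ.filter (fun x => x ∈ P) = P := by ext; simp
    have h3 := Finset.card_filter_add_card_filter_not (s := univ) (fun x => x ∈ P)
    rw [h2, Finset.card_univ] at h3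
    rw [h2, ← h3]
    push_cast
    ring

end Moments

section Count

theorem card_filter_supp_compl {C : Finset (BF 7)} (hC : ∀ g, g ∈ C ↔ DegLT 3 g) {w : ℕ}
    (hw : w ≤ 128) : (C.filter (fun g => (supp g).card = 128 - w)).card =
      (C.filter (fun g => (supp g).card = w)).card := by
  have hone : ∀ g : BF 7, DegLT 3 g → DegLT 3 (g + 1) := fun g hg =>
    hg.add ((degLT_const 1).mono (by omega))
  have hcard : ∀ g : BF 7, (supp (g + 1)).card + (supp g).card = 128 := fun g =>
    (card_supp_add_one g).trans (by simp)
  refine Finset.card_bij (fun g _ => g + 1) ?_ (fun g _ g' _ h => add_right_cancel h) ?_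
  · intro g hg
    rw [mem_filter, hC] at *
    have := hcard g
    exact ⟨hone g hg.1, by omega⟩
  · intro g hg
    rw [mem_filter, hC] at hg
    have := hcard g
    exact ⟨g + 1, mem_filter.mpr ⟨(hC _).mpr (hone g hg.1), by omega⟩, add_add_cancel g 1⟩

theorem sum_card_filter_mul {C : Finset (BF 7)} (hC : ∀ g, g ∈ C ↔ DegLT 3 g) {j : ℕ} (hj : j < 8) :
    ∑ w ∈ ({0, 32, 48, 56, 64, 72, 80, 96, 128} : Finset ℕ),
      ((C.filter (fun g => (supp g).card = w)).card : ℤ) * (128 - 2 * w) ^ j =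
      C.card * momentValue 128 j 0 := by
  have h1 := moment_eq (k := 2) hC (j := j) (P := ∅) (by simpa using hj)
  have h128 : Fintype.card (Fin 7 → ZMod 2) = 128 := by simp
  simp only [moment, prod_empty, mul_one, sum_sign, card_empty, h128] at h1
  have hmaps : ∀ g ∈ C, (supp g).card ∈ ({0, 32, 48, 56, 64, 72, 80, 96, 128} : Finset ℕ) :=
    fun g hg => card_supp_quadratic ((hC g).mp hg) h128
  rw [← h1, ← Finset.sum_fiberwise_of_maps_to hmaps]
  refine Finset.sum_congr rfl fun w _ => ?_
  rw [Finset.sum_congr rfl (g := fun _ => ((128 : ℤ) - 2 * w) ^ j), Finset.sum_const, nsmul_eq_mul]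
  intro g hg
  rw [(mem_filter.mp hg).2]
  norm_num

theorem sum_weights (F : ℕ → ℤ) :
    ∑ w ∈ ({0, 32, 48, 56, 64, 72, 80, 96, 128} : Finset ℕ), F w =
      F 0 + F 32 + F 48 + F 56 + F 64 + F 72 + F 80 + F 96 + F 128 := by
  iterate 8 rw [Finset.sum_insert (by decide)]
  rw [Finset.sum_singleton]
  ring

theorem card_quadratic_eq_56 {C : Finset (BF 7)} (hC : ∀ g, g ∈ C ↔ DegLT 3 g) :
    (C.filter (fun g => (supp g).card = 56)).card = 112881664 := by
  have hcard : C.card = 2 ^ 29 := by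
    have hRM : C = RM 2 7 := by
      ext g
      rw [hC, mem_RM_iff]
    rw [hRM, card_RM_two_seven]
  have h0 : (C.filter (fun g => (supp g).card = 0)).card = 1 := by
    rw [Finset.card_eq_one]
    refine ⟨0, ?_⟩
    ext g
    rw [mem_filter, card_eq_zero, supp_eq_empty, mem_singleton, and_iff_right_iff_imp]
    rintro rfl
    rw [hC]; exact degLT_zero 3
  have c0 : (C.filter (fun g => (supp g).card = 128)).card = _ :=
    card_filter_supp_compl hC (w := 0) (by norm_num)
  have c32 : (C.filter (fun g => (supp g).card = 96)).card = _ :=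
    card_filter_supp_compl hC (w := 32) (by norm_num)
  have c48 : (C.filter (fun g => (supp g).card = 80)).card = _ :=
    card_filter_supp_compl hC (w := 48) (by norm_num)
  have c56 : (C.filter (fun g => (supp g).card = 72)).card = _ :=
    card_filter_supp_compl hC (w := 56) (by norm_num)
  have m0 := sum_card_filter_mul hC (j := 0) (by norm_num)
  have m2 := sum_card_filter_mul hC (j := 2) (by norm_num)
  have m4 := sum_card_filter_mul hC (j := 4) (by norm_num)
  have m6 := sum_card_filter_mul hC (j := 6) (by norm_num)
  have v0 : momentValue 128 0 0 = 1 := by decide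
  have v2 : momentValue 128 2 0 = 128 := by decide
  have v4 : momentValue 128 4 0 = 48896 := by decide
  have v6 : momentValue 128 6 0 = 30967808 := by decide +kernel
  rw [sum_weights, hcard, c0, c32, c48, c56, h0] at m0 m2 m4 m6
  rw [v0] at m0
  rw [v2] at m2
  rw [v4] at m4
  rw [v6] at m6
  generalize (C.filter (fun g => (supp g).card = 32)).card = a at *
  generalize (C.filter (fun g => (supp g).card = 48)).card = b at *
  generalize (C.filter (fun g => (supp g).card = 56)).card = c at *
  generalize (C.filter (fun g => (supp g).card = 64)).card = d at *
  clear c0 c32 c48 c56 h0 hcard v0 v2 v4 v6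
  norm_num at m0 m2 m4 m6
  omega

end Count

section Subspaces

variable {V : Type*} [AddCommGroup V] [Module (ZMod 2) V]

/-- The family `b` is linearly independent modulo `S`. -/
def IndepMod {k : ℕ} (S : Submodule (ZMod 2) V) (b : Fin k → V) : Prop :=
  ∀ c : Fin k → ZMod 2, ∑ j, c j • b j ∈ S → c = 0

/-- The subspace generated by `S` and the family `b`. -/
def extend {k : ℕ} (S : Submodule (ZMod 2) V) (b : Fin k → V) : Submodule (ZMod 2) V :=
  LinearMap.range (S.subtype.coprod (Fintype.linearCombination (ZMod 2) b))

theorem mem_extend {k : ℕ} {S : Submodule (ZMod 2) V} {b : Fin k → V} {x : V} :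
    x ∈ extend S b ↔ ∃ s ∈ S, ∃ c : Fin k → ZMod 2, s + ∑ j, c j • b j = x := by
  simp [extend, LinearMap.mem_range, Fintype.linearCombination_apply]

theorem le_extend {k : ℕ} (S : Submodule (ZMod 2) V) (b : Fin k → V) : S ≤ extend S b :=
  fun s hs => mem_extend.mpr ⟨s, hs, 0, by simp⟩

theorem apply_mem_extend {k : ℕ} (S : Submodule (ZMod 2) V) (b : Fin k → V) (j : Fin k) :
    b j ∈ extend S b :=
  mem_extend.mpr ⟨0, S.zero_mem, Pi.single j 1, by simp [Pi.single_apply]⟩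

theorem extend_le {k : ℕ} {S W : Submodule (ZMod 2) V} {b : Fin k → V} (hS : S ≤ W)
    (hb : ∀ j, b j ∈ W) : extend S b ≤ W := by
  intro x hx
  obtain ⟨s, hs, c, rfl⟩ := mem_extend.mp hx
  exact W.add_mem (hS hs) (W.sum_mem fun j _ => W.smul_mem _ (hb j))

theorem IndepMod.card_extend [Finite V] {k : ℕ} {S : Submodule (ZMod 2) V} {b : Fin k → V}
    (h : IndepMod S b) : Nat.card (extend S b) = Nat.card S * 2 ^ k := by
  have hinj : Function.Injective (S.subtype.coprod (Fintype.linearCombination (ZMod 2) b)) := by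
    rw [injective_iff_map_eq_zero]
    rintro ⟨s, c⟩ hsc
    have hsum : (s : V) + ∑ j, c j • b j = 0 := by
      simpa [Fintype.linearCombination_apply] using hsc
    have hc : c = 0 := h c (by
      rw [eq_neg_of_add_eq_zero_right hsum]
      exact S.neg_mem s.2)
    subst hc
    simpa using hsum
  rw [extend, ← Nat.card_congr (LinearEquiv.ofInjective _ hinj).toEquiv, Nat.card_prod,
    Nat.card_fun]
  simp

theorem indepMod_cons {k : ℕ} {S : Submodule (ZMod 2) V} {x : V} {b : Fin k → V} :
    IndepMod S (Fin.cons x b : Fin (k + 1) → V) ↔ IndepMod S b ∧ x ∉ extend S b := by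
  constructor
  · refine fun h => ⟨fun c hc => ?_, fun hx => ?_⟩
    · have := h (Fin.cons 0 c) (by simpa [Fin.sum_univ_succ] using hc)
      funext j
      simpa using congrFun this j.succ
    · obtain ⟨s, hs, c, rfl⟩ := mem_extend.mp hx
      have := h (Fin.cons 1 c) (by simpa [Fin.sum_univ_succ, add_add_cancel] using hs)
      simpa using congrFun this 0
  · rintro ⟨hb, hx⟩ c hc
    simp only [Fin.sum_univ_succ, Fin.cons_zero, Fin.cons_succ] at hc
    rcases zmod_two_cases (c 0) with h0 | h0
    · rw [h0, zero_smul, zero_add] at hc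
      have := hb _ hc
      funext j
      refine Fin.cases h0 (fun j => congrFun this j) j
    · rw [h0, one_smul] at hc
      exact absurd (mem_extend.mpr ⟨_, hc, fun j => c j.succ, add_add_cancel _ _⟩) hx

variable [Fintype V]

open Classical in
theorem card_filter_mem_submodule (W : Submodule (ZMod 2) V) :
    (univ.filter (fun x => x ∈ W)).card = Nat.card W := by
  rw [Nat.card_eq_fintype_card, Fintype.card_subtype]

open Classical in
/-- The number of families in `W` that are independent modulo `S`. -/
theorem card_indepMod {S W : Submodule (ZMod 2) V} (hSW : S ≤ W) (k : ℕ) :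
    (univ.filter (fun b : Fin k → V => (∀ j, b j ∈ W) ∧ IndepMod S b)).card =
      ∏ j ∈ range k, (Nat.card W - Nat.card S * 2 ^ j) := by
  induction k with
  | zero =>
    rw [range_zero, prod_empty, card_eq_one]
    refine ⟨Fin.elim0, ?_⟩
    ext b
    simp only [mem_filter, mem_univ, true_and, mem_singleton]
    refine ⟨fun _ => Subsingleton.elim _ _, fun _ => ⟨fun j => j.elim0, fun c _ => ?_⟩⟩
    exact Subsingleton.elim _ _
  | succ k ih =>
    rw [prod_range_succ, ← ih, ← smul_eq_mul, ← sum_const]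
    have hext : ∀ b ∈ univ.filter (fun b : Fin k → V => (∀ j, b j ∈ W) ∧ IndepMod S b),
        (univ.filter (fun x => x ∈ W ∧ x ∉ extend S b)).card =
          Nat.card W - Nat.card S * 2 ^ k := by
      intro b hb
      simp only [mem_filter, mem_univ, true_and] at hb
      rw [← hb.2.card_extend, ← card_filter_mem_submodule, ← card_filter_mem_submodule,
        ← card_sdiff_of_subset]
      · congr 1
        ext x
        simp
      · intro x
        simp only [mem_filter, mem_univ, true_and]
        exact fun hx => extend_le hSW hb.1 hx
    rw [← sum_congr rfl hext, ← card_sigma]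
    symm
    refine card_bij (fun z _ => (Fin.cons z.2 z.1 : Fin (k + 1) → V)) ?_ ?_ ?_
    · rintro ⟨b, x⟩ hz
      simp only [mem_sigma, mem_filter, mem_univ, true_and] at hz ⊢
      exact ⟨Fin.cases hz.2.1 hz.1.1, indepMod_cons.mpr ⟨hz.1.2, hz.2.2⟩⟩
    · rintro ⟨b, x⟩ _ ⟨b', x'⟩ _ h
      obtain ⟨rfl, rfl⟩ := Fin.cons_inj.mp h
      rfl
    · intro b hb
      simp only [mem_filter, mem_univ, true_and] at hb
      have h2 := hb.2
      rw [← Fin.cons_self_tail b, indepMod_cons] at h2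
      refine ⟨⟨Fin.tail b, b 0⟩, ?_, Fin.cons_self_tail b⟩
      simp only [mem_sigma, mem_filter, mem_univ, true_and]
      exact ⟨⟨fun j => hb.1 j.succ, h2.1⟩, hb.1 0, h2.2⟩

open Classical in
/-- Counts the subspaces of given dimension that meet `T` exactly in `S`. -/
theorem card_submodules_mul {S T : Submodule (ZMod 2) V} (hST : S ≤ T) (k : ℕ) :
    (univ.filter (fun W : Submodule (ZMod 2) V => W ⊓ T = S ∧
      Nat.card W = Nat.card S * 2 ^ k)).card *
        ∏ j ∈ range k, (Nat.card S * 2 ^ k - Nat.card S * 2 ^ j) =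
      ∏ j ∈ range k, (Fintype.card V - Nat.card T * 2 ^ j) := by
  have htop := card_indepMod (le_top : T ≤ ⊤) k
  rw [show Nat.card (⊤ : Submodule (ZMod 2) V) = Fintype.card V by
    rw [← card_filter_mem_submodule]; simp] at htop
  simp only [Submodule.mem_top, implies_true, true_and] at htop
  have hinf : ∀ b : Fin k → V, IndepMod T b → extend S b ⊓ T = S := by
    refine fun b hb => le_antisymm (fun x hx => ?_) (le_inf (le_extend S b) hST)
    obtain ⟨s, hs, c, rfl⟩ := mem_extend.mp hx.1
    have hc : c = 0 := hb c (by simpa using T.sub_mem hx.2 (hST hs))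
    simpa [hc] using hs
  rw [← htop, ← smul_eq_mul, ← sum_const]
  rw [card_eq_sum_card_fiberwise (f := fun b => extend S b)
    (t := univ.filter (fun W : Submodule (ZMod 2) V => W ⊓ T = S ∧
      Nat.card W = Nat.card S * 2 ^ k))]
  · refine sum_congr rfl fun W hW => ?_
    simp only [mem_filter, mem_univ, true_and] at hW
    have hSW : S ≤ W := hW.1 ▸ inf_le_left
    rw [← hW.2, ← card_indepMod hSW, filter_filter]
    congr 1
    ext b
    simp only [mem_filter, mem_univ, true_and]
    constructor
    · rintro ⟨hb, hS⟩
      refine ⟨fun c hc => hS c ?_, ?_⟩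
      · rw [← hW.1]
        exact ⟨W.sum_mem fun j _ => W.smul_mem _ (hb j), hc⟩
      · refine SetLike.coe_injective (Set.eq_of_subset_of_ncard_le (extend_le hSW hb) ?_)
        exact (hW.2.trans hS.card_extend.symm).le
    · rintro ⟨hb, rfl⟩
      exact ⟨apply_mem_extend S b, fun c hc => hb c (hST hc)⟩
  · intro b hb
    simp only [coe_filter, mem_univ, true_and, Set.mem_ofPred_eq] at hb ⊢
    refine ⟨hinf b hb, IndepMod.card_extend fun c hc => hb c (hST hc)⟩

end Subspaces

section Flats

variable {V : Type*} [AddCommGroup V] [Module (ZMod 2) V] [Fintype V] [DecidableEq V]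

open Classical in
/-- The translate of the subspace `W` by `p`. -/
noncomputable def translate (p : V) (W : Submodule (ZMod 2) V) : Finset V :=
  univ.filter (fun x => x + p ∈ W)

theorem mem_translate {p x : V} {W : Submodule (ZMod 2) V} : x ∈ translate p W ↔ x + p ∈ W := by
  simp [translate]

theorem self_mem_translate (p : V) (W : Submodule (ZMod 2) V) : p ∈ translate p W := by
  rw [mem_translate, add_self]; exact W.zero_mem

theorem isFlat_translate (p : V) (W : Submodule (ZMod 2) V) : IsFlat (translate p W) := by
  refine ⟨⟨p, self_mem_translate p W⟩, fun x hx y hy z hz => ?_⟩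
  rw [mem_translate] at *
  have h : x + y + z + p = x + p + (y + p) + (z + p) := by
    rw [← add_add_cancel (x + y + z + p) p]; abel
  rw [h]
  exact W.add_mem (W.add_mem hx hy) hz

theorem card_translate (p : V) (W : Submodule (ZMod 2) V) : (translate p W).card = Nat.card W :=
  card_eq_card_submodule fun _ => mem_translate

theorem translate_inter (p : V) (W W' : Submodule (ZMod 2) V) :
    translate p W ∩ translate p W' = translate p (W ⊓ W') := by
  ext x
  simp [mem_translate]

theorem translate_injective (p : V) : Function.Injective (translate p) := by
  intro W W' h
  ext x
  have := Finset.ext_iff.mp h (x + p)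
  rwa [mem_translate, mem_translate, add_add_cancel] at this

theorem IsFlat.eq_translate {A : Finset V} (hA : IsFlat A) {p : V} (hp : p ∈ A) :
    ∃ W, A = translate p W := by
  obtain ⟨W, hW⟩ := hA.exists_submodule hp
  exact ⟨W, Finset.ext fun x => by rw [hW, mem_translate]⟩

open Classical in
theorem card_flats_mul (d : ℕ) :
    (univ.filter (fun A : Finset V => IsFlat A ∧ A.card = d)).card * d =
      Fintype.card V * (univ.filter (fun W : Submodule (ZMod 2) V => Nat.card W = d)).card := by
  rw [← card_univ, ← card_product, ← smul_eq_mul, ← sum_const,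
    sum_congr rfl (fun A hA => (mem_filter.mp hA).2.2.symm), ← card_sigma]
  symm
  refine card_bij (fun z _ => (⟨translate z.1 z.2, z.1⟩ : (_ : Finset V) × V)) ?_ ?_ ?_
  · rintro ⟨p, W⟩ hz
    simp only [mem_product, mem_sigma, mem_filter, mem_univ, true_and] at hz ⊢
    exact ⟨⟨isFlat_translate p W, (card_translate p W).trans hz⟩, self_mem_translate p W⟩
  · rintro ⟨p, W⟩ _ ⟨p', W'⟩ _ h
    obtain ⟨h, h'⟩ := Sigma.mk.inj h
    obtain rfl : p = p' := eq_of_heq h'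
    exact Prod.ext rfl (translate_injective p h)
  · rintro ⟨A, p⟩ hz
    simp only [mem_sigma, mem_filter, mem_univ, true_and] at hz
    obtain ⟨W, rfl⟩ := hz.1.1.eq_translate hz.2
    refine ⟨⟨p, W⟩, ?_, rfl⟩
    simp only [mem_product, mem_filter, mem_univ, true_and]
    exact (card_translate p W).symm.trans hz.1.2

open Classical in
/-- Ordered pairs of flats with `d` points that meet in `e` points. -/
noncomputable def flatPairs (V : Type*) [AddCommGroup V] [Module (ZMod 2) V] [Fintype V] (d e : ℕ) :
    Finset (Finset V × Finset V) :=
  univ.filter (fun z => (IsFlat z.1 ∧ z.1.card = d) ∧ (IsFlat z.2 ∧ z.2.card = d) ∧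
    (z.1 ∩ z.2).card = e)

open Classical in
/-- Ordered pairs of subspaces with `d` points that meet in `e` points. -/
noncomputable def submodulePairs (V : Type*) [AddCommGroup V] [Module (ZMod 2) V] [Fintype V]
    (d e : ℕ) : Finset (Submodule (ZMod 2) V × Submodule (ZMod 2) V) :=
  univ.filter (fun z => Nat.card z.1 = d ∧ Nat.card z.2 = d ∧
    Nat.card (z.1 ⊓ z.2 : Submodule (ZMod 2) V) = e)

theorem mem_flatPairs {d e : ℕ} {z : Finset V × Finset V} : z ∈ flatPairs V d e ↔
    (IsFlat z.1 ∧ z.1.card = d) ∧ (IsFlat z.2 ∧ z.2.card = d) ∧ (z.1 ∩ z.2).card = e := by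
  simp only [flatPairs, mem_filter, mem_univ, true_and]
  convert Iff.rfl

theorem mem_submodulePairs {d e : ℕ} {z : Submodule (ZMod 2) V × Submodule (ZMod 2) V} :
    z ∈ submodulePairs V d e ↔ Nat.card z.1 = d ∧ Nat.card z.2 = d ∧
      Nat.card (z.1 ⊓ z.2 : Submodule (ZMod 2) V) = e := by
  simp only [submodulePairs, mem_filter, mem_univ, true_and]

theorem card_flatPairs_mul (d e : ℕ) :
    (flatPairs V d e).card * e = Fintype.card V * (submodulePairs V d e).card := by
  rw [← card_univ, ← card_product, ← smul_eq_mul, ← sum_const,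
    sum_congr rfl (fun z hz => (mem_flatPairs.mp hz).2.2.symm), ← card_sigma]
  symm
  refine card_bij (fun z _ => (⟨(translate z.1 z.2.1, translate z.1 z.2.2), z.1⟩ :
    (_ : Finset V × Finset V) × V)) ?_ ?_ ?_
  · rintro ⟨p, W, W'⟩ hz
    simp only [mem_product, mem_sigma, mem_univ, true_and, mem_submodulePairs, mem_flatPairs,
      isFlat_translate, card_translate, translate_inter, self_mem_translate, and_true] at hz ⊢
    exact hz
  · rintro ⟨p, W, Z⟩ _ ⟨p', W', Z'⟩ _ h
    obtain ⟨h, h'⟩ := Sigma.mk.inj h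
    obtain rfl : p = p' := eq_of_heq h'
    obtain ⟨h1, h2⟩ := Prod.mk.inj h
    exact Prod.ext rfl (Prod.ext (translate_injective p h1) (translate_injective p h2))
  · rintro ⟨⟨A, B⟩, p⟩ hz
    simp only [mem_sigma, mem_flatPairs, mem_inter] at hz
    obtain ⟨W, rfl⟩ := hz.1.1.1.eq_translate hz.2.1
    obtain ⟨W', rfl⟩ := hz.1.2.1.1.eq_translate hz.2.2
    refine ⟨⟨p, W, W'⟩, ?_, rfl⟩
    simp only [isFlat_translate, card_translate, translate_inter, true_and] at hz
    simpa only [mem_product, mem_univ, true_and, mem_submodulePairs] using hz.1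

open Classical in
theorem card_submodules_card_eq_mul (k : ℕ) :
    (univ.filter (fun W : Submodule (ZMod 2) V => Nat.card W = 2 ^ k)).card *
        ∏ j ∈ range k, (2 ^ k - 2 ^ j) = ∏ j ∈ range k, (Fintype.card V - 2 ^ j) := by
  simpa using card_submodules_mul (le_refl (⊥ : Submodule (ZMod 2) V)) k

theorem card_submodulePairs {i k a b c : ℕ}
    (ha : a * ∏ j ∈ range i, (2 ^ i - 2 ^ j) = ∏ j ∈ range i, (Fintype.card V - 2 ^ j))
    (hb : b * ∏ j ∈ range k, (2 ^ i * 2 ^ k - 2 ^ i * 2 ^ j) =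
      ∏ j ∈ range k, (Fintype.card V - 2 ^ i * 2 ^ j))
    (hc : c * ∏ j ∈ range k, (2 ^ i * 2 ^ k - 2 ^ i * 2 ^ j) =
      ∏ j ∈ range k, (Fintype.card V - 2 ^ i * 2 ^ k * 2 ^ j)) :
    (submodulePairs V (2 ^ i * 2 ^ k) (2 ^ i)).card = a * (b * c) := by
  classical
  have pos : ∀ (s k : ℕ), 0 < ∏ j ∈ range k, (2 ^ s * 2 ^ k - 2 ^ s * 2 ^ j) := fun s k =>
    prod_pos fun j hj => Nat.sub_pos_of_lt (Nat.mul_lt_mul_of_pos_left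
      (Nat.pow_lt_pow_right (by norm_num) (mem_range.mp hj)) (by positivity))
  have hA : (univ.filter (fun D : Submodule (ZMod 2) V => Nat.card D = 2 ^ i)).card = a :=
    Nat.eq_of_mul_eq_mul_right (by simpa using pos 0 i)
      ((card_submodules_card_eq_mul i).trans ha.symm)
  rw [← hA, card_eq_sum_card_fiberwise (f := fun z => z.1 ⊓ z.2)
    (t := univ.filter (fun D : Submodule (ZMod 2) V => Nat.card D = 2 ^ i))
    (fun z hz => by simpa using (mem_submodulePairs.mp hz).2.2),]
  refine sum_const_nat fun D hD => ?_
  have hD' : Nat.card D = 2 ^ i := (mem_filter.mp hD).2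
  have hB := card_submodules_mul (le_refl D) k
  rw [hD', ← hb] at hB
  rw [← Nat.eq_of_mul_eq_mul_right (pos i k) hB, card_eq_sum_card_fiberwise (f := Prod.fst)
    (t := univ.filter (fun W : Submodule (ZMod 2) V => W ⊓ D = D ∧
      Nat.card W = 2 ^ i * 2 ^ k))]
  · refine sum_const_nat fun W hW => ?_
    obtain ⟨hWD, hW⟩ := (mem_filter.mp hW).2
    have hC := card_submodules_mul (inf_eq_right.mp hWD) k
    rw [hD', hW, ← hc] at hC
    rw [← Nat.eq_of_mul_eq_mul_right (pos i k) hC]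
    refine card_bij (fun z _ => z.2) ?_ ?_ ?_
    · intro z hz
      simp only [mem_filter, mem_submodulePairs, mem_univ, true_and] at hz ⊢
      obtain ⟨⟨⟨-, h2, -⟩, h4⟩, rfl⟩ := hz
      exact ⟨by rw [inf_comm, h4], h2⟩
    · intro z hz z' hz' h
      exact Prod.ext ((mem_filter.mp hz).2.trans (mem_filter.mp hz').2.symm) h
    · intro Z hZ
      simp only [mem_filter, mem_univ, true_and] at hZ
      refine ⟨(W, Z), ?_, rfl⟩
      simp only [mem_filter, mem_submodulePairs, and_true]
      rw [inf_comm, hZ.1]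
      exact ⟨⟨hW, hZ.2, hD'⟩, rfl⟩
  · intro z hz
    simp only [coe_filter, mem_submodulePairs, mem_univ, true_and, Set.mem_ofPred_eq] at hz ⊢
    refine ⟨?_, hz.1.1⟩
    rw [← hz.2, ← inf_assoc, inf_idem]

theorem card_flatPairs_four (hV : Fintype.card V = 512) :
    (flatPairs V 32 4).card * 4 = 512 * (43435 * (11811 * 7680)) := by
  rw [card_flatPairs_mul, hV]
  congr 1
  exact card_submodulePairs (i := 2) (k := 3) (by rw [hV]; decide +kernel)
    (by rw [hV]; decide +kernel) (by rw [hV]; decide +kernel)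

theorem card_flatPairs_two (hV : Fintype.card V = 512) :
    (flatPairs V 32 2).card * 2 = 512 * (511 * (200787 * 65536)) := by
  rw [card_flatPairs_mul, hV]
  congr 1
  exact card_submodulePairs (i := 1) (k := 4) (by rw [hV]; decide +kernel)
    (by rw [hV]; decide +kernel) (by rw [hV]; decide +kernel)

open Classical in
theorem card_flats_seven (hV : Fintype.card V = 512) :
    (univ.filter (fun A : Finset V => IsFlat A ∧ A.card = 128)).card = 173740 := by
  have h1 := card_flats_mul (V := V) 128
  have h2 := card_submodules_card_eq_mul (V := V) 7
  rw [hV] at h1 h2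
  have h3 : (univ.filter (fun W : Submodule (ZMod 2) V => Nat.card W = 2 ^ 7)).card = 43435 := by
    refine Nat.eq_of_mul_eq_mul_right (m := ∏ j ∈ range 7, (2 ^ 7 - 2 ^ j)) (by decide)
      (h2.trans ?_)
    decide +kernel
  rw [show 2 ^ 7 = 128 by norm_num] at h3
  rw [h3] at h1
  omega

end Flats

section Pairs

variable {V : Type*} [AddCommGroup V] [Module (ZMod 2) V] [Fintype V] [DecidableEq V]

theorem translate_eq_of_mem {p q : V} {W : Submodule (ZMod 2) V} (h : q ∈ translate p W) :
    translate q W = translate p W := by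
  rw [mem_translate] at h
  ext x
  rw [mem_translate, mem_translate]
  have hx : x + q = x + p + (q + p) := by
    rw [← add_add_cancel (x + q) p]; abel
  exact ⟨fun hq => by simpa [hx, add_add_cancel] using W.add_mem hq h,
    fun hp => hx ▸ W.add_mem hp h⟩

theorem card_mul_card_le_submodule {W₁ W₂ W : Submodule (ZMod 2) V} (h₁ : W₁ ≤ W) (h₂ : W₂ ≤ W) :
    Nat.card W₁ * Nat.card W₂ ≤ Nat.card W * Nat.card (W₁ ⊓ W₂ : Submodule (ZMod 2) V) := by
  simp only [card_submodule, ← pow_add]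
  refine Nat.pow_le_pow_right (by norm_num) ?_
  rw [← Submodule.finrank_sup_add_finrank_inf_eq]
  exact Nat.add_le_add_right (Submodule.finrank_mono (sup_le h₁ h₂)) _

theorem IsFlat.card_mul_card_le {A B F : Finset V} (hA : IsFlat A) (hB : IsFlat B) (hF : IsFlat F)
    (hAB : (A ∩ B).Nonempty) (hAF : A ⊆ F) (hBF : B ⊆ F) :
    A.card * B.card ≤ F.card * (A ∩ B).card := by
  obtain ⟨p, hp⟩ := hAB
  rw [mem_inter] at hp
  obtain ⟨W₁, rfl⟩ := hA.eq_translate hp.1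
  obtain ⟨W₂, rfl⟩ := hB.eq_translate hp.2
  obtain ⟨W, rfl⟩ := hF.eq_translate (hAF hp.1)
  have le : ∀ W', translate p W' ⊆ translate p W → W' ≤ W := fun W' h x hx => by
    have := h (mem_translate.mpr (by rwa [add_add_cancel] : x + p + p ∈ W'))
    rwa [mem_translate, add_add_cancel] at this
  rw [translate_inter, card_translate, card_translate, card_translate, card_translate]
  exact card_mul_card_le_submodule (le _ hAF) (le _ hBF)

theorem IsFlat.inter_card_eq {A B : Finset V} (hA : IsFlat A) (hB : IsFlat B)
    {k : ℕ} (hk : 2 ^ k < (A ∩ B).card) (hk' : (A ∩ B).card ≤ 2 ^ (k + 1)) :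
    (A ∩ B).card = 2 ^ (k + 1) := by
  obtain ⟨m, hm⟩ := (hA.inter hB (card_pos.mp (by omega))).card_eq_two_pow
  rw [hm] at hk hk' ⊢
  rw [Nat.pow_lt_pow_iff_right (by norm_num)] at hk
  rw [Nat.pow_le_pow_iff_right (by norm_num)] at hk'
  congr 1
  omega

/-- Two flats with 32 points meeting in few points are determined by their symmetric difference,
up to order. -/
theorem eq_or_eq_of_symmDiff_eq {A B A' B' : Finset V} (hA : IsFlat A) (hA32 : A.card = 32)
    (hB : IsFlat B) (hB32 : B.card = 32) (hAB : (A ∩ B).Nonempty) (hAB4 : (A ∩ B).card ≤ 4)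
    (hA' : IsFlat A') (hA32' : A'.card = 32) (hAB4' : (A' ∩ B').card ≤ 4)
    (h : symmDiff A B = symmDiff A' B') : A' = A ∨ A' = B := by
  have hsub : A' \ B' ⊆ (A' ∩ A) ∪ (A' ∩ B) := by
    intro x hx
    have h1 : x ∈ symmDiff A B := by
      rw [h, mem_symmDiff]
      exact Or.inl (mem_sdiff.mp hx)
    rw [mem_symmDiff] at h1
    simp only [mem_sdiff, mem_union, mem_inter] at hx ⊢
    tauto
  have hcard := (card_le_card hsub).trans (card_union_le _ _)
  have h28 := card_sdiff_add_card_inter A' B'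
  by_contra! hne
  have half : ∀ C : Finset V, IsFlat C → C.card = 32 → A' ≠ C → (A' ∩ C).card ≤ 16 := by
    intro C hC hC32 hneq
    by_contra! hlt
    have h32 := hA'.inter_card_eq hC (k := 4) (by simpa using hlt)
      (by simpa [hA32'] using card_le_card (inter_subset_left (s₁ := A') (s₂ := C)))
    have e1 : A' ∩ C = A' := eq_of_subset_of_card_le inter_subset_left (by omega)
    have e2 : A' ∩ C = C := eq_of_subset_of_card_le inter_subset_right (by omega)
    exact hneq (e1.symm.trans e2)
  have hA16 := half A hA hA32 hne.1
  have hB16 := half B hB hB32 hne.2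
  have hA16' := hA'.inter_card_eq hA (k := 3) (by norm_num; omega) (by norm_num; omega)
  have hB16' := hA'.inter_card_eq hB (k := 3) (by norm_num; omega) (by norm_num; omega)
  obtain ⟨p, hp⟩ := hAB
  rw [mem_inter] at hp
  obtain ⟨s, hs⟩ := card_pos.mp (by omega : 0 < (A' ∩ A).card)
  obtain ⟨t, ht⟩ := card_pos.mp (by omega : 0 < (A' ∩ B).card)
  rw [mem_inter] at hs ht
  obtain ⟨W₁, rfl⟩ := hA.eq_translate hp.1
  obtain ⟨W₂, rfl⟩ := hB.eq_translate hp.2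
  obtain ⟨W, rfl⟩ := hA'.eq_translate hs.1
  rw [translate_inter, card_translate] at hAB4
  rw [← translate_eq_of_mem hs.2, translate_inter, card_translate] at hA16'
  rw [← translate_eq_of_mem ht.1, ← translate_eq_of_mem ht.2, translate_inter,
    card_translate] at hB16'
  rw [card_translate] at hA32'
  have h1 := card_mul_card_le_submodule (inf_le_left : W ⊓ W₁ ≤ W) (inf_le_left : W ⊓ W₂ ≤ W)
  have h2 : Nat.card ((W ⊓ W₁) ⊓ (W ⊓ W₂) : Submodule (ZMod 2) V) ≤
      Nat.card (W₁ ⊓ W₂ : Submodule (ZMod 2) V) :=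
    Nat.card_mono (Set.toFinite _) (inf_le_inf inf_le_right inf_le_right)
  rw [hA16', hB16', hA32'] at h1
  omega

open Classical in
theorem card_image_flatPairs {e : ℕ} (he : 0 < e) (he4 : e ≤ 4) :
    ((flatPairs V 32 e).image (fun z => ind z.1 + ind z.2)).card * 2 = (flatPairs V 32 e).card := by
  rw [card_eq_sum_card_image (fun z : Finset V × Finset V => (ind z.1 + ind z.2 : V → ZMod 2))
    (flatPairs V 32 e)]
  symm
  refine sum_const_nat fun f hf => ?_
  obtain ⟨⟨A, B⟩, hz, rfl⟩ := Finset.mem_image.mp hf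
  have hz' := mem_flatPairs.mp hz
  obtain ⟨⟨hA, hA32⟩, ⟨hB, hB32⟩, hAB⟩ := hz'
  dsimp only at hA hA32 hB hB32 hAB
  have hne : A ≠ B := by
    rintro rfl
    rw [inter_self] at hAB
    omega
  refine Eq.trans (congrArg card ?_) (card_pair (a := (A, B)) (b := (B, A)) (by simp [hne]))
  ext ⟨A', B'⟩
  simp only [mem_filter, mem_insert, mem_singleton, Prod.mk.injEq]
  constructor
  · rintro ⟨hz2, hf2⟩
    obtain ⟨⟨hA', hA32'⟩, -, hAB'⟩ := mem_flatPairs.mp hz2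
    dsimp only at hA' hA32' hAB'
    rcases eq_or_eq_of_symmDiff_eq hA hA32 hB hB32 (card_pos.mp (by omega)) (by omega) hA' hA32'
      (B' := B') (by omega) (by simpa [supp_add] using congrArg supp hf2.symm) with rfl | rfl
    · exact Or.inl ⟨rfl, by simpa using congrArg supp (add_left_cancel hf2)⟩
    · rw [add_comm (ind A)] at hf2
      exact Or.inr ⟨rfl, by simpa using congrArg supp (add_left_cancel hf2)⟩
  · rintro (⟨rfl, rfl⟩ | ⟨rfl, rfl⟩)
    · exact ⟨hz, rfl⟩
    · refine ⟨mem_flatPairs.mpr ⟨⟨hB, hB32⟩, ⟨hA, hA32⟩, ?_⟩, add_comm _ _⟩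
      dsimp only
      rwa [inter_comm]

open Classical in
theorem degLT_and_card_of_mem_image_flatPairs (hV : Fintype.card V = 512) {e : ℕ}
    {f : V → ZMod 2} (hf : f ∈ (flatPairs V 32 e).image (fun z => ind z.1 + ind z.2)) :
    DegLT 5 f ∧ (supp f).card + 2 * e = 64 := by
  obtain ⟨⟨A, B⟩, hz, rfl⟩ := Finset.mem_image.mp hf
  obtain ⟨⟨hA, hA32⟩, ⟨hB, hB32⟩, hAB⟩ := mem_flatPairs.mp hz
  dsimp only at hA hA32 hB hB32 hAB
  dsimp only
  refine ⟨(degLT_ind (k := 4) hA (by omega)).add (degLT_ind (k := 4) hB (by omega)), ?_⟩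
  have := card_symmDiff_add A B
  rw [supp_add, supp_ind, supp_ind, ← hAB]
  omega

open Classical in
theorem ind_add_ind_mem_image {A B : Finset V} (hA : IsFlat A) (hA32 : A.card = 32) (hB : IsFlat B)
    (hB32 : B.card = 32) {e : ℕ} (h : (supp (ind A + ind B)).card + 2 * e = 64) :
    ind A + ind B ∈ (flatPairs V 32 e).image (fun z => ind z.1 + ind z.2) := by
  refine Finset.mem_image.mpr ⟨(A, B), mem_flatPairs.mpr ⟨⟨hA, hA32⟩, ⟨hB, hB32⟩, ?_⟩, rfl⟩
  have := card_symmDiff_add A B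
  rw [supp_add, supp_ind, supp_ind] at h
  dsimp only
  omega

end Pairs

section WeightCount

variable {V : Type*} [AddCommGroup V] [Module (ZMod 2) V] [Fintype V] [DecidableEq V]

theorem exists_notMem_add_notMem {W : Submodule (ZMod 2) V}
    (hW : 4 * Nat.card W ≤ Fintype.card V) : ∃ a b, a ∉ W ∧ b ∉ W ∧ b + a ∉ W := by
  have hpos : 0 < Nat.card W := Nat.card_pos
  have key : ∀ S : Finset V, S.card < Fintype.card V → ∃ x, x ∉ S := by
    intro S hS
    by_contra! h
    rw [eq_univ_of_forall h, card_univ] at hS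
    omega
  obtain ⟨a, ha⟩ := key (translate 0 W) (by rw [card_translate]; omega)
  obtain ⟨b, hb⟩ := key (translate 0 W ∪ translate a W) (by
    refine (card_union_le _ _).trans_lt ?_
    rw [card_translate, card_translate]
    omega)
  rw [mem_union, mem_translate, mem_translate, not_or, add_zero] at hb
  rw [mem_translate, add_zero] at ha
  exact ⟨a, b, ha, hb.1, hb.2⟩

/-- Restricting a function to a flat of codimension two outside of which it vanishes lowers the
degree by two. -/
theorem DegLT.restrict_translate {k : ℕ} {f : V → ZMod 2} (hf : DegLT (k + 2) f) {p : V}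
    {W : Submodule (ZMod 2) V} (hW : 4 * Nat.card W ≤ Fintype.card V)
    (hs : supp f ⊆ translate p W) : DegLT k (fun y : W => f (y + p)) := by
  obtain ⟨a, b, ha, hb, hba⟩ := exists_notMem_add_notMem hW
  convert (hf a b).comp W.subtype p using 2 with y
  have zero : ∀ d, d ∉ W → f (y + p + d) = 0 := by
    intro d hd
    refine notMem_supp.mp fun h => hd ?_
    have hy := mem_translate.mp (hs h)
    have e : (y : V) + p + d + p = y + d := by
      rw [add_right_comm (y : V), add_assoc, add_self, add_zero]
    rw [e] at hy
    exact (W.add_mem_iff_right y.2).mp hy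
  simp only [diff, Submodule.subtype_apply]
  rw [add_assoc ((y : V) + p), zero _ hba, zero _ ha, zero _ hb]
  simp

theorem degLT_ind_mul_comp {k : ℕ} {g : BF 7} (hg : DegLT k g) {p : V} {W : Submodule (ZMod 2) V}
    (hW : Fintype.card V = 4 * Nat.card W) (ψ : V →ₗ[ZMod 2] (Fin 7 → ZMod 2)) :
    DegLT (k + 2) (ind (translate p W) * fun x => g (ψ x + ψ p)) := by
  have h := (degLT_ind (k := 2) (isFlat_translate p W) (by rw [card_translate]; omega)).mul
    (hg.comp ψ (ψ p))
  exact h.mono (by omega)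

theorem nonempty_linearEquiv_submodule {n : ℕ} {W : Submodule (ZMod 2) V}
    (hW : Nat.card W = 2 ^ n) : Nonempty ((Fin n → ZMod 2) ≃ₗ[ZMod 2] W) := by
  rw [card_submodule] at hW
  exact ⟨LinearEquiv.ofFinrankEq _ _
    ((Module.finrank_fin_fun (ZMod 2)).trans (Nat.pow_right_injective le_rfl hW).symm)⟩

set_option linter.constructorNameAsVariable false in
open Classical in
theorem card_supp_subset_translate (hV : Fintype.card V = 512) {p : V}
    {W : Submodule (ZMod 2) V} (hW : Nat.card W = 128) (w : ℕ) :
    (univ.filter (fun f : V → ZMod 2 => (DegLT 5 f ∧ (supp f).card = w) ∧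
      supp f ⊆ translate p W)).card =
    ((univ.filter (fun g : BF 7 => DegLT 3 g)).filter (fun g => (supp g).card = w)).card := by
  obtain ⟨e⟩ := nonempty_linearEquiv_submodule (n := 7) (hW.trans (by norm_num))
  obtain ⟨ψ, hψ⟩ := e.symm.toLinearMap.exists_extend
  have hψe : ∀ y : W, ψ y = e.symm y := fun y => LinearMap.congr_fun hψ y
  have hmem : ∀ y, (e y : V) + p ∈ translate p W := fun y => by
    rw [mem_translate, add_add_cancel]; exact (e y).2
  have hrep : ∀ x ∈ translate p W, ∃ y, x = (e y : V) + p := fun x hx => by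
    refine ⟨e.symm ⟨x + p, mem_translate.mp hx⟩, ?_⟩
    rw [LinearEquiv.apply_symm_apply, add_add_cancel]
  have hψp : ∀ y, ψ ((e y : V) + p) + ψ p = y := fun y => by
    rw [map_add, add_add_cancel, hψe, LinearEquiv.symm_apply_apply]
  have hinj : Function.Injective (fun y => (e y : V) + p) := fun y z h => by
    rw [← hψp y, ← hψp z]
    exact congrArg (fun x => ψ x + ψ p) h
  have hsupp : ∀ f : V → ZMod 2, supp f ⊆ translate p W →
      supp f = (supp (fun y => f ((e y : V) + p))).image (fun y => (e y : V) + p) := by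
    intro f hf
    ext x
    simp only [Finset.mem_image, mem_supp]
    constructor
    · intro hx
      obtain ⟨y, rfl⟩ := hrep x (hf (mem_supp.mpr hx))
      exact ⟨y, hx, rfl⟩
    · rintro ⟨y, hy, rfl⟩; exact hy
  have hcard : ∀ f : V → ZMod 2, supp f ⊆ translate p W →
      (supp (fun y => f ((e y : V) + p))).card = (supp f).card := fun f hf => by
    rw [hsupp f hf, card_image_of_injective _ hinj]
  refine card_bij (fun f _ y => f ((e y : V) + p)) ?_ ?_ ?_
  · intro f hf
    simp only [mem_filter, mem_univ, true_and] at hf ⊢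
    refine ⟨?_, (hcard f hf.2).trans hf.1.2⟩
    have h := (hf.1.1.restrict_translate (by omega) hf.2).comp e.toLinearMap 0
    simpa using h
  · intro f hf f' hf' h
    simp only [mem_filter, mem_univ, true_and] at hf hf' h
    exact supp_injective (by rw [hsupp f hf.2, hsupp f' hf'.2, h])
  · intro g hg
    simp only [mem_filter, mem_univ, true_and] at hg
    have hsub : supp (ind (translate p W) * fun x => g (ψ x + ψ p)) ⊆ translate p W := by
      rw [supp_mul, supp_ind]
      exact inter_subset_left
    have hres : (fun y => (ind (translate p W) * fun x => g (ψ x + ψ p)) ((e y : V) + p)) = g := by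
      funext y
      simp only [Pi.mul_apply, hψp]
      rw [ind, if_pos (hmem y), one_mul]
    refine ⟨_, ?_, hres⟩
    simp only [mem_filter, mem_univ, true_and]
    refine ⟨⟨degLT_ind_mul_comp hg.1 (by omega) ψ, ?_⟩, hsub⟩
    rw [← hcard _ hsub, hres, hg.2]

theorem IsFlat.eq_of_supp_subset (hV : Fintype.card V = 512) {F F' : Finset V} (hF : IsFlat F)
    (hF128 : F.card = 128) (hF' : IsFlat F') (hF128' : F'.card = 128) {f : V → ZMod 2}
    (hf : DegLT 5 f) (hw : (supp f).card = 56) (hs : supp f ⊆ F) (hs' : supp f ⊆ F') : F = F' := by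
  have hsub : supp f ⊆ F ∩ F' := subset_inter hs hs'
  have hle := card_le_card hsub
  have hG : IsFlat (F ∩ F') := hF.inter hF' (card_pos.mp (by omega))
  by_cases h64 : (F ∩ F').card ≤ 64
  · have h64' := hF.inter_card_eq hF' (k := 5) (by norm_num; omega) (by simpa using h64)
    have hdeg : DegLT 5 (f + ind (F ∩ F')) := hf.add (degLT_ind (k := 3) hG (by omega)).succ
    have hcard : (supp (f + ind (F ∩ F'))).card = 8 := by
      have h1 := card_symmDiff_add (supp f) (F ∩ F')
      rw [inter_eq_left.mpr hsub] at h1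
      rw [supp_add, supp_ind]
      omega
    have h0 : f + ind (F ∩ F') ≠ 0 := by
      rw [Ne, ← supp_eq_empty, ← card_eq_zero]
      omega
    have := card_le_of_degLT hdeg h0
    omega
  · have h128 := hF.inter_card_eq hF' (k := 6) (by norm_num; omega)
      (by simpa [hF128] using card_le_card (inter_subset_left (s₁ := F) (s₂ := F')))
    have e1 : F ∩ F' = F := eq_of_subset_of_card_le inter_subset_left (by omega)
    have e2 : F ∩ F' = F' := eq_of_subset_of_card_le inter_subset_right (by omega)
    exact e1.symm.trans e2

open Classical in
/-- The number of functions of weight 56 and degree at most four supported in a flat of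
codimension two. -/
theorem card_filter_exists_flat (hV : Fintype.card V = 512) :
    (univ.filter (fun f : V → ZMod 2 => (DegLT 5 f ∧ (supp f).card = 56) ∧
      ∃ F, IsFlat F ∧ F.card = 128 ∧ supp f ⊆ F)).card = 173740 * 112881664 := by
  have hU : univ.filter (fun f : V → ZMod 2 => (DegLT 5 f ∧ (supp f).card = 56) ∧
      ∃ F, IsFlat F ∧ F.card = 128 ∧ supp f ⊆ F) =
      (univ.filter (fun F : Finset V => IsFlat F ∧ F.card = 128)).biUnion (fun F =>
        univ.filter (fun f : V → ZMod 2 => (DegLT 5 f ∧ (supp f).card = 56) ∧ supp f ⊆ F)) := by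
    ext f
    simp only [mem_filter, mem_univ, true_and, mem_biUnion]
    constructor
    · rintro ⟨h, F, h1, h2, h3⟩; exact ⟨F, ⟨h1, h2⟩, h, h3⟩
    · rintro ⟨F, ⟨h1, h2⟩, h, h3⟩; exact ⟨h, F, h1, h2, h3⟩
  rw [hU, card_biUnion, ← card_flats_seven hV]
  · refine sum_const_nat fun F hF => ?_
    obtain ⟨hF, hF128⟩ := (mem_filter.mp hF).2
    obtain ⟨p, hp⟩ := hF.1
    obtain ⟨W, rfl⟩ := hF.eq_translate hp
    rw [card_translate] at hF128
    rw [card_supp_subset_translate hV hF128, card_quadratic_eq_56 fun g => by simp]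
  · intro F hF F' hF' hne
    simp only [coe_filter, mem_univ, true_and] at hF hF'
    refine disjoint_left.mpr fun f hf hf' => hne ?_
    simp only [mem_filter, mem_univ, true_and] at hf hf'
    exact hF.1.eq_of_supp_subset hV hF.2 hF'.1 hF'.2 hf.1.1 hf.1.2 hf.2 hf'.2

theorem not_supp_subset_flat {A B F : Finset V} (hA : IsFlat A) (hA32 : A.card = 32) (hB : IsFlat B)
    (hB32 : B.card = 32) (hF : IsFlat F) (hF128 : F.card = 128)
    (hw : (supp (ind A + ind B)).card = 56) : ¬ supp (ind A + ind B) ⊆ F := by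
  intro hs
  rw [supp_add, supp_ind, supp_ind] at hw hs
  have hAB := card_symmDiff_add A B
  have sub : ∀ C D : Finset V, IsFlat C → C.card = 32 → (C ∩ D).card = 4 → C \ D ⊆ F → C ⊆ F := by
    intro C D hC hC32 hCD hCF
    have h1 : C \ D ⊆ C ∩ F := subset_inter sdiff_subset hCF
    have h2 := card_sdiff_add_card_inter C D
    have h3 := card_le_card h1
    have h4 := hC.inter_card_eq hF (k := 4) (by norm_num; omega)
      (by simpa [hC32] using card_le_card (inter_subset_left (s₁ := C) (s₂ := F)))
    exact inter_eq_left.mp (eq_of_subset_of_card_le inter_subset_left (by omega))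
  have hAF := sub A B hA hA32 (by omega) fun x hx =>
    hs (mem_symmDiff.mpr (Or.inl (mem_sdiff.mp hx)))
  have hBF := sub B A hB hB32 (by rw [inter_comm]; omega) fun x hx =>
    hs (mem_symmDiff.mpr (Or.inr (mem_sdiff.mp hx)))
  have := hA.card_mul_card_le hB hF (card_pos.mp (by omega)) hAF hBF
  rw [hA32, hB32, hF128] at this
  omega

open Classical in
theorem card_filter_eq_60 (hV : Fintype.card V = 512) :
    (univ.filter (fun f : V → ZMod 2 => DegLT 5 f ∧ (supp f).card = 60)).card =
      860689275027456 := by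
  have hU : univ.filter (fun f : V → ZMod 2 => DegLT 5 f ∧ (supp f).card = 60) =
      (flatPairs V 32 2).image (fun z => ind z.1 + ind z.2) := by
    ext f
    rw [mem_filter]
    constructor
    · rintro ⟨-, hf, hw⟩
      obtain ⟨A, B, hA, hA32, hB, hB32, rfl⟩ := exists_flats_of_card_eq_60 hf hV hw
      exact ind_add_ind_mem_image hA hA32 hB hB32 (by omega)
    · intro hf
      have h := degLT_and_card_of_mem_image_flatPairs hV hf
      exact ⟨mem_univ _, h.1, by omega⟩
  have h1 := card_image_flatPairs (V := V) (e := 2) (by norm_num) (by norm_num)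
  have h2 := card_flatPairs_two hV
  rw [hU]
  omega

open Classical in
theorem card_filter_eq_56 (hV : Fintype.card V = 512) :
    (univ.filter (fun f : V → ZMod 2 => DegLT 5 f ∧ (supp f).card = 56)).card =
      271767121346560 := by
  have hU : univ.filter (fun f : V → ZMod 2 => DegLT 5 f ∧ (supp f).card = 56) =
      (flatPairs V 32 4).image (fun z => ind z.1 + ind z.2) ∪
      univ.filter (fun f : V → ZMod 2 => (DegLT 5 f ∧ (supp f).card = 56) ∧
        ∃ F, IsFlat F ∧ F.card = 128 ∧ supp f ⊆ F) := by
    ext f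
    rw [mem_union, mem_filter, mem_filter]
    constructor
    · rintro ⟨-, hf, hw⟩
      rcases exists_flats_of_card_eq_56 hf hV hw with ⟨A, B, hA, hA32, hB, hB32, rfl⟩ | hF
      · exact Or.inl (ind_add_ind_mem_image hA hA32 hB hB32 (by omega))
      · exact Or.inr ⟨mem_univ _, ⟨hf, hw⟩, hF⟩
    · rintro (hf | hf)
      · have h := degLT_and_card_of_mem_image_flatPairs hV hf
        exact ⟨mem_univ _, h.1, by omega⟩
      · exact ⟨mem_univ _, hf.2.1⟩
  have hdisj : Disjoint ((flatPairs V 32 4).image (fun z => ind z.1 + ind z.2))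
      (univ.filter (fun f : V → ZMod 2 => (DegLT 5 f ∧ (supp f).card = 56) ∧
        ∃ F, IsFlat F ∧ F.card = 128 ∧ supp f ⊆ F)) := by
    refine disjoint_left.mpr fun f hf hf' => ?_
    obtain ⟨⟨A, B⟩, hz, rfl⟩ := Finset.mem_image.mp hf
    obtain ⟨⟨hA, hA32⟩, ⟨hB, hB32⟩, -⟩ := mem_flatPairs.mp hz
    obtain ⟨-, ⟨-, hw⟩, F, hF, hF128, hs⟩ := mem_filter.mp hf'
    exact not_supp_subset_flat hA hA32 hB hB32 hF hF128 hw hs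
  have h1 := card_image_flatPairs (V := V) (e := 4) (by norm_num) (by norm_num)
  have h2 := card_flatPairs_four hV
  rw [hU, card_union_of_disjoint hdisj, card_filter_exists_flat hV]
  omega

end WeightCount

end BoolFun

/-- `R(4,9)` has exactly `271767121346560` codewords of weight `56` and exactly
`860689275027456` codewords of weight `60`. -/
theorem statement12 :
    ((RM 4 9).filter (fun f => wt f = 56)).card = 271767121346560 ∧
    ((RM 4 9).filter (fun f => wt f = 60)).card = 860689275027456 := by
  classical
  have hV : Fintype.card (Fin 9 → ZMod 2) = 512 := by simp
  constructor
  · refine Eq.trans (congrArg card (Finset.ext fun f => ?_)) (BoolFun.card_filter_eq_56 hV)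
    rw [mem_filter, mem_filter, BoolFun.mem_RM_iff, and_iff_right (mem_univ f)]
    exact Iff.rfl
  · refine Eq.trans (congrArg card (Finset.ext fun f => ?_)) (BoolFun.card_filter_eq_60 hV)
    rw [mem_filter, mem_filter, BoolFun.mem_RM_iff, and_iff_right (mem_univ f)]
    exact Iff.rfl
end

section
/- Every codeword of the Reed–Muller code R(4,9) has Hamming weight divisible by 4. -/
open Finset Polynomial

/-- The monomial `∏_{i ∈ S} x i`, as a Boolean function. -/
def monomialBF {m : ℕ} (S : Finset (Fin m)) : BF m := fun x => ∏ i ∈ S, x i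

/-- The set of coordinates at which `x` equals `1`. -/
def oneSupport {m : ℕ} (x : Fin m → ZMod 2) : Finset (Fin m) :=
  Finset.univ.filter (fun i => x i = 1)

theorem monomialBF_apply {m : ℕ} (S : Finset (Fin m)) (x : Fin m → ZMod 2) :
    monomialBF S x = if S ⊆ oneSupport x then 1 else 0 := by
  unfold monomialBF
  split_ifs with h
  · exact Finset.prod_eq_one fun i hi => by simpa [oneSupport] using h hi
  · obtain ⟨i, hi, hx⟩ := Finset.not_subset.mp h
    refine Finset.prod_eq_zero hi ?_
    have key : ∀ a : ZMod 2, a ≠ 1 → a = 0 := by decide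
    exact key _ (by simpa [oneSupport] using hx)

theorem monomialBF_mul {m : ℕ} (S T : Finset (Fin m)) :
    monomialBF S * monomialBF T = monomialBF (S ∪ T) := by
  funext x
  simp only [Pi.mul_apply, monomialBF_apply, Finset.union_subset_iff]
  split_ifs <;> simp_all

theorem oneSupport_injective {m : ℕ} :
    Function.Injective (oneSupport : (Fin m → ZMod 2) → Finset (Fin m)) := by
  intro x y h
  funext i
  have hi : x i = 1 ↔ y i = 1 := by simpa [oneSupport] using Finset.ext_iff.mp h i
  have key : ∀ a b : ZMod 2, (a = 1 ↔ b = 1) → a = b := by decide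
  exact key _ _ hi

theorem card_Icc_finset_zmod_two {α : Type*} [DecidableEq α] (s t : Finset α) :
    ((Finset.Icc s t).card : ZMod 2) = if s = t then 1 else 0 := by
  split_ifs with h
  · simp [h]
  · by_cases hst : s ⊆ t
    · have hlt : s.card < t.card := Finset.card_lt_card (hst.ssubset_of_ne h)
      rw [Finset.card_Icc_finset hst, Nat.cast_pow]
      have h2 : ((2 : ℕ) : ZMod 2) = 0 := by decide
      rw [h2, zero_pow (by omega)]
    · rw [Finset.Icc_eq_empty (by simpa using hst)]
      simp

/-- Every Boolean function is the sum of its algebraic normal form. -/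
theorem sum_anf_mul_monomialBF {m : ℕ} (f : BF m) (x : Fin m → ZMod 2) :
    ∑ S, anf f S * monomialBF S x = f x := by
  have hS : ∀ S, anf f S * monomialBF S x =
      ∑ y, if S ∈ Finset.Icc (oneSupport y) (oneSupport x) then f y else 0 := by
    intro S
    have hy : ∀ y : Fin m → ZMod 2, (∀ i, y i = 1 → i ∈ S) ↔ oneSupport y ⊆ S := by
      intro y
      simp [oneSupport, Finset.subset_iff]
    simp only [anf, hy, Finset.sum_filter, monomialBF_apply, Finset.sum_mul, Finset.mem_Icc]
    refine Finset.sum_congr rfl fun y _ => ?_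
    split_ifs <;> simp_all
  simp_rw [hS]
  rw [Finset.sum_comm]
  have hy : ∀ y, (∑ S, if S ∈ Finset.Icc (oneSupport y) (oneSupport x) then f y else 0) =
      if y = x then f y else 0 := by
    intro y
    rw [Finset.sum_ite_mem, Finset.univ_inter, Finset.sum_const, nsmul_eq_mul,
      card_Icc_finset_zmod_two]
    simp [oneSupport_injective.eq_iff]
  simp_rw [hy]
  simp

theorem eq_sum_monomialBF {m : ℕ} (f : BF m) :
    f = ∑ S ∈ Finset.univ.filter (fun S => anf f S ≠ 0), monomialBF S := by
  funext x
  rw [Finset.sum_apply, Finset.sum_filter, ← sum_anf_mul_monomialBF f x]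
  refine Finset.sum_congr rfl fun S _ => ?_
  have key : ∀ a b : ZMod 2, a * b = if a ≠ 0 then b else 0 := by decide
  exact key _ _

theorem wt_eq_sum_val {m : ℕ} (f : BF m) : wt f = ∑ x, (f x).val := by
  have key : ∀ a : ZMod 2, a.val = if a = 1 then 1 else 0 := by decide
  simp_rw [wt, key]
  exact Finset.card_filter _ _

theorem wt_add {m : ℕ} (f g : BF m) : wt (f + g) + 2 * wt (f * g) = wt f + wt g := by
  have key : ∀ a b : ZMod 2, (a + b).val + 2 * (a * b).val = a.val + b.val := by decide
  simp only [wt_eq_sum_val, Finset.mul_sum, ← Finset.sum_add_distrib, Pi.add_apply, Pi.mul_apply,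
    key]

theorem wt_zero {m : ℕ} : wt (0 : BF m) = 0 := by
  simp [wt_eq_sum_val]

theorem wt_monomialBF {m : ℕ} (S : Finset (Fin m)) : wt (monomialBF S) = 2 ^ (m - S.card) := by
  have h : Finset.univ.filter (fun x => monomialBF S x = 1) =
      Fintype.piFinset fun i => if i ∈ S then ({1} : Finset (ZMod 2)) else Finset.univ := by
    ext x
    simp only [monomialBF_apply, Finset.mem_filter_univ, Fintype.mem_piFinset, ite_eq_left_iff,
      zero_ne_one, imp_false, not_not, Finset.subset_iff, oneSupport]
    refine forall_congr' fun i => ?_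
    split_ifs with hi <;> simp [hi]
  rw [wt, h, Fintype.card_piFinset]
  simp only [apply_ite Finset.card, Finset.card_singleton, Finset.card_univ, ZMod.card]
  rw [Finset.prod_ite, Finset.prod_const_one, one_mul, Finset.prod_const, Finset.filter_not,
    Finset.filter_mem_eq_inter, Finset.univ_inter, Finset.card_univ_sdiff, Fintype.card_fin]

theorem two_dvd_wt_sum {ι : Type*} {m : ℕ} (A : Finset ι) (g : ι → BF m)
    (hg : ∀ i ∈ A, 2 ∣ wt (g i)) : 2 ∣ wt (∑ i ∈ A, g i) := by
  refine Finset.sum_induction g (fun f => 2 ∣ wt f) (fun a b ha hb => ?_) (by simp [wt_zero]) hg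
  have := wt_add a b
  omega

theorem four_dvd_wt_sum {ι : Type*} {m : ℕ} (A : Finset ι) (g : ι → BF m)
    (hg : ∀ i ∈ A, 4 ∣ wt (g i)) (hgg : ∀ i ∈ A, ∀ j ∈ A, 2 ∣ wt (g i * g j)) :
    4 ∣ wt (∑ i ∈ A, g i) := by
  classical
  induction A using Finset.induction_on with
  | empty => simp [wt_zero]
  | insert i A hi ih =>
    rw [Finset.sum_insert hi]
    have hadd := wt_add (g i) (∑ j ∈ A, g j)
    rw [Finset.mul_sum] at hadd
    have hprod := two_dvd_wt_sum A (fun j => g i * g j) fun j hj =>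
      hgg i (Finset.mem_insert_self i A) j (Finset.mem_insert_of_mem hj)
    have hhead := hg i (Finset.mem_insert_self i A)
    have htail := ih (fun j hj => hg j (Finset.mem_insert_of_mem hj)) fun j hj k hk =>
      hgg j (Finset.mem_insert_of_mem hj) k (Finset.mem_insert_of_mem hk)
    omega

theorem four_dvd_wt_of_mem_RM {r m : ℕ} (h : 2 * r < m) (hr : r + 2 ≤ m) :
    ∀ f ∈ RM r m, 4 ∣ wt f := by
  intro f hf
  have hcard : ∀ S ∈ Finset.univ.filter (fun S => anf f S ≠ 0), S.card ≤ r := by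
    intro S hS
    by_contra hlt
    exact (Finset.mem_filter.mp hS).2 ((Finset.mem_filter.mp hf).2 S (by omega))
  rw [eq_sum_monomialBF f]
  refine four_dvd_wt_sum _ _ (fun S hS => ?_) fun S hS T hT => ?_
  · rw [wt_monomialBF]
    have := hcard S hS
    exact pow_dvd_pow 2 (show 2 ≤ m - S.card by omega)
  · rw [monomialBF_mul, wt_monomialBF]
    have hS := hcard S hS
    have hT := hcard T hT
    have := Finset.card_union_le S T
    exact dvd_pow_self 2 (by omega)

/-- Every codeword of `R(4,9)` has Hamming weight divisible by `4`. -/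
theorem statement16 : ∀ f ∈ RM 4 9, 4 ∣ wt f :=
  four_dvd_wt_of_mem_RM (by norm_num) (by norm_num)
end
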